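/- W^{1,p} bound with localized right-hand side, a priori form (Lemma 2.3, convex case): Let Ω ⊂ ℝ³ be a bounded convex open set. There exist constants α ∈ (0, 1/2) and C > 0, depending only on Ω, such that for every p with 3/2 − α ≤ p ≤ 3 + α, every point x₀ ∈ ℝ³ and every d* > 0 with dist(x₀, ∂Ω) ≤ d*, the following holds: if v is twice continuously differentiable on closure(Ω), vanishes on ∂Ω, and its Laplacian Δv vanishes at every point of Ω outside the closed ball of radius d* centered at x₀, then ‖v‖_{W^{1,p}(Ω)} ≤ C d* ‖Δv‖_{L^p(Ω)}. -/

import Mathlib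

open MeasureTheory Metric Set
open scoped RealInnerProductSpace ENNReal NNReal

noncomputable section

/-- Three-dimensional Euclidean space. -/
abbrev E3 : Type := EuclideanSpace ℝ (Fin 3)

/-- A convex polyhedron: a bounded convex open set which is the interior of the
convex hull of a finite set of points. -/
def IsConvexPolyhedron (Ω : Set E3) : Prop :=
  IsOpen Ω ∧ Bornology.IsBounded Ω ∧ Convex ℝ Ω ∧
    ∃ S : Finset E3, Ω = interior (convexHull ℝ (S : Set E3))

/-- The closed tetrahedron with vertices `v 0, v 1, v 2, v 3`. -/
def tet (v : Fin 4 → E3) : Set E3 := convexHull ℝ (Set.range v)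

/-- A quasi-uniform conforming tetrahedral partition of `Ω` with mesh size `h`
and quasi-uniformity constant `c`, recorded by the vertex tuples of its tetrahedra. -/
def IsTetPartition (Ω : Set E3) (T : Finset (Fin 4 → E3)) (h c : ℝ) : Prop :=
  (∀ v ∈ T, AffineIndependent ℝ v) ∧
  (⋃ v ∈ T, tet v) = closure Ω ∧
  (∀ v ∈ T, ∀ w ∈ T, tet v ≠ tet w → interior (tet v) ∩ interior (tet w) = ∅) ∧
  (∀ v ∈ T, ∀ w ∈ T, tet v ≠ tet w →
    tet v ∩ tet w = ∅ ∨ tet v ∩ tet w = convexHull ℝ (Set.range v ∩ Set.range w)) ∧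
  (∀ v ∈ T, Metric.diam (tet v) ≤ h) ∧
  (∀ v ∈ T, ∃ x : E3, Metric.closedBall x (c * h) ⊆ tet v)

/-- The finite element space `S_h` of continuous piecewise polynomials of degree `≤ r`. -/
def MemSh (Ω : Set E3) (T : Finset (Fin 4 → E3)) (r : ℕ) (u : E3 → ℝ) : Prop :=
  ContinuousOn u (closure Ω) ∧
  ∀ v ∈ T, ∃ p : MvPolynomial (Fin 3) ℝ,
    p.totalDegree ≤ r ∧ ∀ x ∈ tet v, u x = MvPolynomial.eval (fun i => x i) p

/-- The subspace `S̊_h` of finite element functions vanishing on the boundary. -/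
def MemSh0 (Ω : Set E3) (T : Finset (Fin 4 → E3)) (r : ℕ) (u : E3 → ℝ) : Prop :=
  MemSh Ω T r u ∧ ∀ x ∈ frontier Ω, u x = 0

/-- The Laplacian, as the trace of the Hessian. -/
def lap (v : E3 → ℝ) (x : E3) : ℝ :=
  ∑ i : Fin 3,
    fderiv ℝ (fun y => fderiv ℝ v y (EuclideanSpace.single i 1)) x (EuclideanSpace.single i 1)

/-- The `L^p(A)` norm. -/
def LpN (A : Set E3) (p : ℝ) (w : E3 → ℝ) : ℝ := (∫ x in A, |w x| ^ p) ^ (1 / p)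

/-- The `W^{1,p}(A)` norm. -/
def W1pN (A : Set E3) (p : ℝ) (w : E3 → ℝ) : ℝ :=
  (∫ x in A, (|w x| ^ p + ‖gradient w x‖ ^ p)) ^ (1 / p)

/-- The `W^{2,p}(A)` norm. -/
def W2pN (A : Set E3) (p : ℝ) (w : E3 → ℝ) : ℝ :=
  (∫ x in A, (|w x| ^ p + ‖gradient w x‖ ^ p + ‖iteratedFDeriv ℝ 2 w x‖ ^ p)) ^ (1 / p)

/-- partial derivative -/
def pd (i : Fin 3) (f : E3 → ℝ) (x : E3) : ℝ := fderiv ℝ f x (EuclideanSpace.single i 1)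

theorem lap_eq (v : E3 → ℝ) (x : E3) : lap v x = ∑ i, pd i (pd i v) x := rfl

theorem pd_congr {i : Fin 3} {f g : E3 → ℝ} {x : E3} (h : f =ᶠ[nhds x] g) : pd i f x = pd i g x := by
  unfold pd; rw [h.fderiv_eq]

theorem pd_congr' {i : Fin 3} {f g : E3 → ℝ} {x : E3} (h : f =ᶠ[nhds x] g) :
    pd i f =ᶠ[nhds x] pd i g := by
  filter_upwards [h.eventuallyEq_nhds] with y hy using pd_congr hy

theorem lap_congr {f g : E3 → ℝ} {x : E3} (h : f =ᶠ[nhds x] g) : lap f x = lap g x := by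
  rw [lap_eq, lap_eq]
  exact Finset.sum_congr rfl fun i _ => pd_congr (pd_congr' h)

theorem hasFDerivAt_coord (i : Fin 3) (x : E3) :
    HasFDerivAt (fun y : E3 => y i) (EuclideanSpace.proj i : E3 →L[ℝ] ℝ) x :=
  (EuclideanSpace.proj i : E3 →L[ℝ] ℝ).hasFDerivAt

theorem hasFDerivAt_rad {h : ℝ → ℝ} {h' : ℝ} {x : E3} (H : HasDerivAt h h' (‖x‖ ^ 2)) :
    HasFDerivAt (fun y : E3 => h (‖y‖ ^ 2)) (h' • (2 • innerSL ℝ x)) x := by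
  have := (hasStrictFDerivAt_norm_sq x).hasFDerivAt
  exact H.comp_hasFDerivAt x this

theorem pd_rad {h : ℝ → ℝ} {h' : ℝ} {x : E3} (i : Fin 3) (H : HasDerivAt h h' (‖x‖ ^ 2)) :
    pd i (fun y : E3 => h (‖y‖ ^ 2)) x = 2 * x i * h' := by
  unfold pd
  rw [(hasFDerivAt_rad H).fderiv]
  simp [EuclideanSpace.inner_single_right]
  ring

theorem pd_coord_mul {g : E3 → ℝ} {x : E3} (i j : Fin 3) (H : DifferentiableAt ℝ g x) :
    pd j (fun y : E3 => y i * g y) x = (if i = j then 1 else 0) * g x + x i * pd j g x := by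
  unfold pd
  have h2 : HasFDerivAt (fun y : E3 => y i * g y) _ x := (hasFDerivAt_coord i x).mul H.hasFDerivAt
  rw [h2.fderiv]
  simp [EuclideanSpace.proj]
  ring

theorem pd_const_mul {g : E3 → ℝ} {x : E3} (a : ℝ) (j : Fin 3) :
    pd j (fun y : E3 => a * g y) x = a * pd j g x := by
  unfold pd
  have : (fun y : E3 => a * g y) = a • g := by ext; simp
  rw [this, fderiv_const_smul_field]; simp

theorem pd_add {f g : E3 → ℝ} {x : E3} (j : Fin 3) (hf : DifferentiableAt ℝ f x)
    (hg : DifferentiableAt ℝ g x) :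
    pd j (fun y : E3 => f y + g y) x = pd j f x + pd j g x := by
  unfold pd
  have h2 : HasFDerivAt (fun y : E3 => f y + g y) _ x := hf.hasFDerivAt.add hg.hasFDerivAt
  rw [h2.fderiv]; simp

theorem norm_sq_E3 (x : E3) : ‖x‖ ^ 2 = x 0 ^ 2 + x 1 ^ 2 + x 2 ^ 2 := by
  rw [EuclideanSpace.norm_sq_eq]; simp [Fin.sum_univ_three]

theorem lap_rad {h h1 h2 : ℝ → ℝ} {S : Set ℝ} (hS : IsOpen S)
    (H1 : ∀ t ∈ S, HasDerivAt h (h1 t) t) (H2 : ∀ t ∈ S, HasDerivAt h1 (h2 t) t)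
    {x : E3} (hx : ‖x‖ ^ 2 ∈ S) :
    lap (fun y : E3 => h (‖y‖ ^ 2)) x = 6 * h1 (‖x‖ ^ 2) + 4 * ‖x‖ ^ 2 * h2 (‖x‖ ^ 2) := by
  have hev : ∀ᶠ y : E3 in nhds x, ‖y‖ ^ 2 ∈ S :=
    (continuous_norm.pow 2).continuousAt.eventually (hS.mem_nhds hx)
  rw [lap_eq]
  have key : ∀ i, pd i (pd i (fun y : E3 => h (‖y‖ ^ 2))) x =
      2 * h1 (‖x‖ ^ 2) + 4 * x i ^ 2 * h2 (‖x‖ ^ 2) := by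
    intro i
    have e : pd i (fun y : E3 => h (‖y‖ ^ 2)) =ᶠ[nhds x]
        fun y => y i * (2 * h1 (‖y‖ ^ 2)) := by
      filter_upwards [hev] with y hy
      rw [pd_rad i (H1 _ hy)]; ring
    have d := (hasFDerivAt_rad (H2 _ hx)).differentiableAt
    rw [pd_congr e, pd_coord_mul i i (d.const_mul 2), pd_const_mul 2, pd_rad i (H2 _ hx)]
    simp; ring
  simp only [key, Fin.sum_univ_three]
  rw [norm_sq_E3]; ring

theorem lap_coord_rad {h h1 h2 : ℝ → ℝ} {S : Set ℝ} (hS : IsOpen S)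
    (H1 : ∀ t ∈ S, HasDerivAt h (h1 t) t) (H2 : ∀ t ∈ S, HasDerivAt h1 (h2 t) t)
    {x : E3} (i : Fin 3) (hx : ‖x‖ ^ 2 ∈ S) :
    lap (fun y : E3 => y i * h (‖y‖ ^ 2)) x =
      x i * (10 * h1 (‖x‖ ^ 2) + 4 * ‖x‖ ^ 2 * h2 (‖x‖ ^ 2)) := by
  have hev : ∀ᶠ y : E3 in nhds x, ‖y‖ ^ 2 ∈ S :=
    (continuous_norm.pow 2).continuousAt.eventually (hS.mem_nhds hx)
  rw [lap_eq]
  have d0 := (hasFDerivAt_rad (H1 _ hx)).differentiableAt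
  have d := (hasFDerivAt_rad (H2 _ hx)).differentiableAt
  have key : ∀ j, pd j (pd j (fun y : E3 => y i * h (‖y‖ ^ 2))) x =
      (if i = j then 1 else 0) * (4 * x j * h1 (‖x‖ ^ 2)) + 2 * x i * h1 (‖x‖ ^ 2)
        + 4 * x i * x j ^ 2 * h2 (‖x‖ ^ 2) := by
    intro j
    have e : pd j (fun y : E3 => y i * h (‖y‖ ^ 2)) =ᶠ[nhds x]
        fun y => (if i = j then 1 else 0) * h (‖y‖ ^ 2) + y i * (y j * (2 * h1 (‖y‖ ^ 2))) := by
      filter_upwards [hev] with y hy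
      rw [pd_coord_mul i j (hasFDerivAt_rad (H1 _ hy)).differentiableAt, pd_rad j (H1 _ hy)]; ring
    have d1 : DifferentiableAt ℝ (fun y : E3 => y j * (2 * h1 (‖y‖ ^ 2))) x :=
      (hasFDerivAt_coord j x).differentiableAt.mul (d.const_mul 2)
    have d2 : DifferentiableAt ℝ (fun y : E3 => y i * (y j * (2 * h1 (‖y‖ ^ 2)))) x :=
      (hasFDerivAt_coord i x).differentiableAt.mul d1
    rw [pd_congr e, pd_add j (d0.const_mul _) d2, pd_const_mul, pd_rad j (H1 _ hx),
      pd_coord_mul i j d1, pd_coord_mul j j (d.const_mul 2), pd_const_mul 2, pd_rad j (H2 _ hx)]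
    simp only [if_true]; ring
  simp only [key]
  rw [norm_sq_E3]
  fin_cases i <;> simp [Fin.sum_univ_three] <;> ring

theorem pd_comp_sub (i : Fin 3) (f : E3 → ℝ) (a x : E3) :
    pd i (fun y => f (y - a)) x = pd i f (x - a) := by
  unfold pd; rw [fderiv_comp_sub]

theorem lap_comp_sub (f : E3 → ℝ) (a x : E3) :
    lap (fun y => f (y - a)) x = lap f (x - a) := by
  simp only [lap_eq]
  refine Finset.sum_congr rfl fun i _ => ?_
  rw [show pd i (fun y => f (y - a)) = fun y => pd i f (y - a) from
    funext fun y => pd_comp_sub i f a y, pd_comp_sub]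

theorem lap_comp_add (f : E3 → ℝ) (a x : E3) :
    lap (fun y => f (a + y)) x = lap f (a + x) := by
  have := lap_comp_sub f (-a) x
  simpa [sub_neg_eq_add, add_comm] using this

theorem pd_comp_add (i : Fin 3) (f : E3 → ℝ) (a x : E3) :
    pd i (fun y => f (a + y)) x = pd i f (a + x) := by
  have := pd_comp_sub i f (-a) x
  simpa [sub_neg_eq_add, add_comm] using this

theorem measurable_pd (i : Fin 3) (f : E3 → ℝ) : Measurable (pd i f) :=
  measurable_fderiv_apply_const ℝ f _

theorem measurable_lap (f : E3 → ℝ) : Measurable (lap f) := by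
  have : lap f = fun x => ∑ i, pd i (pd i f) x := rfl
  rw [this]
  exact Finset.measurable_sum _ fun i _ => measurable_pd i _

theorem contDiff_pd {n : WithTop ℕ∞} {f : E3 → ℝ} (hf : ContDiff ℝ (n + 1) f) (i : Fin 3) :
    ContDiff ℝ n (pd i f) :=
  (hf.fderiv_right le_rfl).clm_apply contDiff_const

theorem contDiffAt_pd {f : E3 → ℝ} {x : E3} (hf : ContDiffAt ℝ 2 f x) (i : Fin 3) :
    ContDiffAt ℝ 1 (pd i f) x :=
  (hf.fderiv_right (m := 1) (by norm_num)).clm_apply contDiffAt_const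

theorem continuous_lap {f : E3 → ℝ} (hf : ContDiff ℝ 2 f) : Continuous (lap f) := by
  have : lap f = fun x => ∑ i, pd i (pd i f) x := rfl
  rw [this]
  refine continuous_finsetSum _ fun i _ => ?_
  have h1 : ContDiff ℝ 1 (pd i f) := contDiff_pd (by norm_num; exact hf) i
  have h0 : ContDiff ℝ 0 (pd i (pd i f)) := contDiff_pd (by simpa using h1) i
  exact h0.continuous

theorem hcs_pd {f : E3 → ℝ} (hf : HasCompactSupport f) (i : Fin 3) : HasCompactSupport (pd i f) :=
  hf.fderiv_apply ℝ _

theorem hcs_lap {f : E3 → ℝ} (hf : HasCompactSupport f) : HasCompactSupport (lap f) := by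
  apply HasCompactSupport.intro hf
  intro x hx
  have : f =ᶠ[nhds x] fun _ => 0 := by
    have := notMem_tsupport_iff_eventuallyEq.1 hx
    exact this
  rw [lap_congr this]
  simp [lap]

theorem int_pd {f g : E3 → ℝ} (hf : ContDiff ℝ 1 f) (hg : ContDiff ℝ 1 g)
    (hc : HasCompactSupport g) (i : Fin 3) :
    ∫ x, f x * pd i g x = - ∫ x, pd i f x * g x := by
  have cf : Continuous (pd i f) := (contDiff_pd (n := 0) (by simpa using hf) i).continuous
  have cg : Continuous (pd i g) := (contDiff_pd (n := 0) (by simpa using hg) i).continuous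
  refine integral_mul_fderiv_eq_neg_fderiv_mul_of_integrable ?_ ?_ ?_
    (fun x _ => (hf.differentiable (by norm_num)) x) (fun x _ => (hg.differentiable (by norm_num)) x)
  · exact (cf.mul hg.continuous).integrable_of_hasCompactSupport hc.mul_left
  · exact (hf.continuous.mul cg).integrable_of_hasCompactSupport (hcs_pd hc i).mul_left
  · exact (hf.continuous.mul hg.continuous).integrable_of_hasCompactSupport hc.mul_left

theorem green {f g : E3 → ℝ} (hf : ContDiff ℝ 2 f) (hg : ContDiff ℝ 2 g)
    (hc : HasCompactSupport g) :
    ∫ x, f x * lap g x = ∫ x, lap f x * g x := by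
  have f1 : ∀ i, ContDiff ℝ 1 (pd i f) := fun i => contDiff_pd (by norm_num; exact hf) i
  have g1 : ∀ i, ContDiff ℝ 1 (pd i g) := fun i => contDiff_pd (by norm_num; exact hg) i
  have f0 : ∀ i, Continuous (pd i (pd i f)) := fun i =>
    (contDiff_pd (n := 0) (by simpa using f1 i) i).continuous
  have g0 : ∀ i, Continuous (pd i (pd i g)) := fun i =>
    (contDiff_pd (n := 0) (by simpa using g1 i) i).continuous
  simp only [lap_eq, Finset.mul_sum, Finset.sum_mul]
  rw [integral_finsetSum, integral_finsetSum]
  · refine Finset.sum_congr rfl fun i _ => ?_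
    rw [int_pd (hf.of_le (by norm_num)) (g1 i) (hcs_pd hc i), 
      int_pd (f1 i) (hg.of_le (by norm_num)) hc, neg_neg]
  · intro i _
    exact ((f0 i).mul hg.continuous).integrable_of_hasCompactSupport hc.mul_left
  · intro i _
    exact (hf.continuous.mul (g0 i)).integrable_of_hasCompactSupport (hcs_pd (hcs_pd hc i) i).mul_left

theorem hasDerivAt_pw (l a t : ℝ) (h : 0 < 1 + l ^ 2 * t) :
    HasDerivAt (fun t : ℝ => (1 + l ^ 2 * t) ^ a) (a * l ^ 2 * (1 + l ^ 2 * t) ^ (a - 1)) t := by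
  have h1 : HasDerivAt (fun t : ℝ => 1 + l ^ 2 * t) (l ^ 2) t := by
    simpa using ((hasDerivAt_id t).const_mul (l ^ 2)).const_add 1
  convert h1.rpow_const (p := a) (Or.inl h.ne') using 1
  ring

def pk (l : ℝ) (t : ℝ) : ℝ := 3 * l ^ 3 * (1 + l ^ 2 * t) ^ (-5 / 2 : ℝ)
def pk1 (l : ℝ) (t : ℝ) : ℝ := -(15 / 2) * l ^ 5 * (1 + l ^ 2 * t) ^ (-7 / 2 : ℝ)
def gam (l : ℝ) (t : ℝ) : ℝ := l * (1 + l ^ 2 * t) ^ (-1 / 2 : ℝ)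
def gam1 (l : ℝ) (t : ℝ) : ℝ := -(1 / 2) * l ^ 3 * (1 + l ^ 2 * t) ^ (-3 / 2 : ℝ)
def gam2 (l : ℝ) (t : ℝ) : ℝ := (3 / 4) * l ^ 5 * (1 + l ^ 2 * t) ^ (-5 / 2 : ℝ)
def ph (l : ℝ) (t : ℝ) : ℝ := -l ^ 3 * (1 + l ^ 2 * t) ^ (-3 / 2 : ℝ)
def ph1 (l : ℝ) (t : ℝ) : ℝ := (3 / 2) * l ^ 5 * (1 + l ^ 2 * t) ^ (-5 / 2 : ℝ)
def ph2 (l : ℝ) (t : ℝ) : ℝ := -(15 / 4) * l ^ 7 * (1 + l ^ 2 * t) ^ (-7 / 2 : ℝ)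

theorem hd_pk (l t : ℝ) (h : 0 < 1 + l ^ 2 * t) : HasDerivAt (pk l) (pk1 l t) t := by
  refine HasDerivAt.congr_deriv (f := pk l) ((hasDerivAt_pw l (-5 / 2) t h).const_mul (3 * l ^ 3)) ?_
  unfold pk1; norm_num; ring
theorem hd_gam (l t : ℝ) (h : 0 < 1 + l ^ 2 * t) : HasDerivAt (gam l) (gam1 l t) t := by
  refine HasDerivAt.congr_deriv (f := gam l) ((hasDerivAt_pw l (-1 / 2) t h).const_mul l) ?_
  unfold gam1; norm_num; ring
theorem hd_gam1 (l t : ℝ) (h : 0 < 1 + l ^ 2 * t) : HasDerivAt (gam1 l) (gam2 l t) t := by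
  refine HasDerivAt.congr_deriv (f := gam1 l) ((hasDerivAt_pw l (-3 / 2) t h).const_mul (-(1 / 2) * l ^ 3)) ?_
  unfold gam2; norm_num; ring
theorem hd_ph (l t : ℝ) (h : 0 < 1 + l ^ 2 * t) : HasDerivAt (ph l) (ph1 l t) t := by
  refine HasDerivAt.congr_deriv (f := ph l) ((hasDerivAt_pw l (-3 / 2) t h).const_mul (-l ^ 3)) ?_
  unfold ph1; norm_num; ring
theorem hd_ph1 (l t : ℝ) (h : 0 < 1 + l ^ 2 * t) : HasDerivAt (ph1 l) (ph2 l t) t := by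
  refine HasDerivAt.congr_deriv (f := ph1 l) ((hasDerivAt_pw l (-5 / 2) t h).const_mul (3 / 2 * l ^ 5)) ?_
  unfold ph2; norm_num; ring

theorem isOpen_S (l : ℝ) : IsOpen {t : ℝ | 0 < 1 + l ^ 2 * t} :=
  isOpen_lt continuous_const (by fun_prop)

theorem mem_S (l : ℝ) {t : ℝ} (ht : 0 ≤ t) : 0 < 1 + l ^ 2 * t := by positivity

theorem contDiff_pw (l a : ℝ) : ContDiff ℝ 2 (fun z : E3 => (1 + l ^ 2 * ‖z‖ ^ 2) ^ a) := by
  rw [contDiff_iff_contDiffAt]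
  intro z
  refine ContDiffAt.rpow_const_of_ne ?_ (mem_S l (by positivity)).ne'
  exact contDiffAt_const.add (contDiffAt_const.mul (contDiff_norm_sq ℝ).contDiffAt)

theorem contDiff_gam (l : ℝ) : ContDiff ℝ 2 (fun z : E3 => gam l (‖z‖ ^ 2)) :=
  contDiff_const.mul (contDiff_pw l _)
theorem contDiff_ph (l : ℝ) : ContDiff ℝ 2 (fun z : E3 => ph l (‖z‖ ^ 2)) :=
  contDiff_const.mul (contDiff_pw l _)
theorem contDiff_pk (l : ℝ) : ContDiff ℝ 2 (fun z : E3 => pk l (‖z‖ ^ 2)) :=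
  contDiff_const.mul (contDiff_pw l _)

theorem lap_gam (l : ℝ) (z : E3) : lap (fun z : E3 => gam l (‖z‖ ^ 2)) z = - pk l (‖z‖ ^ 2) := by
  rw [lap_rad (isOpen_S l) (fun t ht => hd_gam l t ht) (fun t ht => hd_gam1 l t ht)
    (mem_S l (by positivity))]
  have hp : 0 < 1 + l ^ 2 * ‖z‖ ^ 2 := by positivity
  unfold gam1 gam2 pk
  have : (1 + l ^ 2 * ‖z‖ ^ 2) ^ (-3 / 2 : ℝ) =
      (1 + l ^ 2 * ‖z‖ ^ 2) * (1 + l ^ 2 * ‖z‖ ^ 2) ^ (-5 / 2 : ℝ) := by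
    rw [← Real.rpow_one_add' hp.le (by norm_num)]; norm_num
  rw [this]; ring

theorem ph_id (l t : ℝ) (ht : 0 ≤ t) : 10 * ph1 l t + 4 * t * ph2 l t = - 2 * pk1 l t := by
  have hp : 0 < 1 + l ^ 2 * t := by positivity
  unfold ph1 ph2 pk1
  have : (1 + l ^ 2 * t) ^ (-5 / 2 : ℝ) =
      (1 + l ^ 2 * t) * (1 + l ^ 2 * t) ^ (-7 / 2 : ℝ) := by
    rw [← Real.rpow_one_add' hp.le (by norm_num)]; norm_num
  rw [this]; ring

/-- normalisation constant -/
def c0 : ℝ := ∫ z : E3, pk 1 (‖z‖ ^ 2)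

theorem integrable_pk1 : Integrable (fun z : E3 => pk 1 (‖z‖ ^ 2)) := by
  have := (integrable_rpow_neg_one_add_norm_sq (E := E3) (μ := volume) (r := 5)
    (by simp; norm_num)).const_mul 3
  refine this.congr (Filter.Eventually.of_forall fun z => ?_)
  simp [pk]

theorem pk_nonneg {l t : ℝ} (hl : 0 ≤ l) (ht : 0 ≤ t) : 0 ≤ pk l t := by
  unfold pk; positivity

theorem c0_pos : 0 < c0 := by
  unfold c0
  rw [integral_pos_iff_support_of_nonneg (fun z => pk_nonneg (by norm_num) (by positivity))
    integrable_pk1]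
  have : Function.support (fun z : E3 => pk 1 (‖z‖ ^ 2)) = univ := by
    ext z; simp only [Function.mem_support, mem_univ, iff_true]
    unfold pk; positivity
  rw [this]; simp

theorem approx_id {h : E3 → ℝ} (hh : Continuous h) (hc : HasCompactSupport h) (x : E3) :
    Filter.Tendsto (fun l : ℝ => ∫ z, pk l (‖z - x‖ ^ 2) * h z) Filter.atTop (nhds (c0 * h x)) := by
  have hc0 := c0_pos
  have key := tendsto_integral_comp_smul_smul_of_integrable' (μ := (volume : Measure E3))
    (φ := fun z : E3 => c0⁻¹ * pk 1 (‖z‖ ^ 2)) (g := h) (x₀ := x)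
    (fun z => mul_nonneg (by positivity) (pk_nonneg (by norm_num) (by positivity)))
    (by rw [integral_const_mul]; exact inv_mul_cancel₀ hc0.ne') ?_
    (hh.integrable_of_hasCompactSupport hc) hh.continuousAt
  · have := key.const_mul c0
    refine this.congr' ?_
    filter_upwards with l
    rw [← integral_const_mul]
    congr 1; ext z
    have : ‖l • (x - z)‖ ^ 2 = l ^ 2 * ‖z - x‖ ^ 2 := by
      rw [norm_smul, mul_pow, norm_sub_rev]; simp
    simp only [this, smul_eq_mul, finrank_euclideanSpace, Fintype.card_fin]
    unfold pk
    field_simp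
  · have h1 : Filter.Tendsto (fun z : E3 => c0⁻¹ * 3 * ‖z‖⁻¹) (Bornology.cobounded E3) (nhds 0) := by
      simpa using (tendsto_norm_cobounded_atTop.inv_tendsto_atTop).const_mul (c0⁻¹ * 3)
    refine squeeze_zero' (Filter.Eventually.of_forall fun z => ?_) ?_ h1
    · exact mul_nonneg (by positivity)
        (mul_nonneg (by positivity) (pk_nonneg (by norm_num) (by positivity)))
    · filter_upwards [tendsto_norm_cobounded_atTop.eventually (Filter.eventually_ge_atTop (1:ℝ))] with z hz
      have hz0 : 0 < ‖z‖ := by linarith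
      simp only [finrank_euclideanSpace, Fintype.card_fin]
      have e : (1 + ‖z‖ ^ 2) ^ (-5 / 2 : ℝ) ≤ ‖z‖ ^ (-5 : ℝ) := by
        calc (1 + ‖z‖ ^ 2) ^ (-5 / 2 : ℝ) ≤ (‖z‖ ^ 2) ^ (-5 / 2 : ℝ) :=
              Real.rpow_le_rpow_of_nonpos (by positivity) (by linarith) (by norm_num)
          _ = _ := by rw [← Real.rpow_natCast, ← Real.rpow_mul hz0.le]; norm_num
      have e2 : ‖z‖ ^ 3 * ‖z‖ ^ (-5 : ℝ) ≤ ‖z‖⁻¹ := by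
        rw [← Real.rpow_natCast, ← Real.rpow_add hz0, ← Real.rpow_neg_one]
        exact Real.rpow_le_rpow_of_exponent_le hz (by norm_num)
      unfold pk
      calc ‖z‖ ^ 3 * (c0⁻¹ * (3 * 1 ^ 3 * (1 + 1 ^ 2 * ‖z‖ ^ 2) ^ (-5 / 2 : ℝ)))
          = c0⁻¹ * 3 * (‖z‖ ^ 3 * (1 + ‖z‖ ^ 2) ^ (-5 / 2 : ℝ)) := by norm_num; ring
        _ ≤ c0⁻¹ * 3 * (‖z‖ ^ 3 * ‖z‖ ^ (-5 : ℝ)) := by gcongr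
        _ ≤ _ := by gcongr

theorem gam_eq (l t : ℝ) (ht : 0 ≤ t) : gam l t = l / √(1 + l ^ 2 * t) := by
  unfold gam
  rw [Real.sqrt_eq_rpow, neg_div, Real.rpow_neg (mem_S l ht).le]; rfl

theorem gam_anti {l A B : ℝ} (hl : 0 < l) (hA : 0 ≤ A) (hAB : A ≤ B) : gam l B ≤ gam l A := by
  rw [gam_eq _ _ hA, gam_eq _ _ (hA.trans hAB)]
  have := mem_S l hA
  gcongr

theorem gam_diff {l A B p q : ℝ} (hl : 0 < l) (hA : 0 < A) (hp : 0 ≤ p) (hq : 0 ≤ q)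
    (hB : B = A + 4 * p * q) (hqB : q ^ 2 ≤ B) : gam l A - gam l B ≤ 2 * p / A := by
  have hAB : A ≤ B := by rw [hB]; nlinarith [mul_nonneg hp hq]
  have hB0 : 0 ≤ B := hA.le.trans hAB
  rw [gam_eq _ _ hA.le, gam_eq _ _ hB0]
  have s0 := mem_S l hA.le
  have S0 := mem_S l hB0
  set s := √(1 + l ^ 2 * A) with hs
  set S := √(1 + l ^ 2 * B) with hS
  have hs2 : s ^ 2 = 1 + l ^ 2 * A := Real.sq_sqrt s0.le
  have hS2 : S ^ 2 = 1 + l ^ 2 * B := Real.sq_sqrt S0.le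
  have sp : 0 < s := Real.sqrt_pos.2 s0
  have Sp : 0 < S := Real.sqrt_pos.2 S0
  have sS : s ≤ S := Real.sqrt_le_sqrt (by gcongr)
  have Sq : l * q ≤ S := by
    apply Real.le_sqrt_of_sq_le
    nlinarith [mul_le_mul_of_nonneg_left hqB (sq_nonneg l)]
  have e : (S - s) * (S + s) = 4 * l ^ 2 * p * q := by
    have : (S - s) * (S + s) = S ^ 2 - s ^ 2 := by ring
    rw [this, hs2, hS2, hB]; ring
  rw [le_div_iff₀ hA, div_sub_div _ _ sp.ne' Sp.ne', div_mul_eq_mul_div, div_le_iff₀ (by positivity)]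
  -- l (S - s) A ≤ 2 p s S
  have h1 : l ^ 2 * A ≤ s ^ 2 := by rw [hs2]; linarith
  have h2 : (l * S - s * l) * A * (S + s) * l ≤ 2 * p * (s * S) * (S + s) * l := by
    calc (l * S - s * l) * A * (S + s) * l = ((S - s) * (S + s)) * (l ^ 2 * A) := by ring
      _ = 4 * l * p * (l * q) * (l ^ 2 * A) := by rw [e]; ring
      _ ≤ 4 * l * p * S * s ^ 2 := by gcongr
      _ = 2 * p * (s * S) * (s + s) * l := by ring
      _ ≤ _ := by gcongr
  exact le_of_mul_le_mul_right (by linarith) (show 0 < (S + s) * l by positivity)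

/-- kernel -/
def kap (z : E3) : ℝ≥0∞ := (‖z‖ₑ ^ 2)⁻¹

theorem ofReal_integral_le {f : E3 → ℝ} (hf : Integrable f) :
    ENNReal.ofReal (∫ x, f x) ≤ ∫⁻ x, ENNReal.ofReal (f x) := by
  rw [integral_eq_lintegral_pos_part_sub_lintegral_neg_part hf]
  refine (ENNReal.ofReal_le_ofReal (sub_le_self _ ENNReal.toReal_nonneg)).trans ?_
  exact ENNReal.ofReal_toReal_le

theorem kap_eq {z : E3} (hz : z ≠ 0) : kap z = ENNReal.ofReal ((‖z‖ ^ 2)⁻¹) := by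
  have : 0 < ‖z‖ := norm_pos_iff.2 hz
  rw [ENNReal.ofReal_inv_of_pos (by positivity), ENNReal.ofReal_pow (norm_nonneg z), ofReal_norm]
  rfl

theorem ae_ne_pt (x : E3) : ∀ᵐ y : E3, y ≠ x := by
  have := measure_singleton (μ := (volume : Measure E3)) x
  exact compl_mem_ae_iff.mpr this

theorem upper {u : E3 → ℝ} (hu : ContDiff ℝ 2 u) (hc : HasCompactSupport u)
    {n : E3} (hn : ‖n‖ = 1) {a : ℝ} (hs : ∀ y ∈ tsupport u, ⟪n, y⟫ < a)
    {g : E3 → ℝ≥0∞} (hg : ∀ y, ENNReal.ofReal (- lap u y) ≤ g y) {x : E3} (hx : ⟪n, x⟫ < a) :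
    ENNReal.ofReal (c0 * u x) ≤
      ∫⁻ y, ENNReal.ofReal (2 * min (a - ⟪n, x⟫) (a - ⟪n, y⟫)) * kap (x - y) * g y := by
  set x' : E3 := x + (2 * (a - ⟪n, x⟫)) • n with hx'
  have hnn : ⟪n, n⟫ = 1 := by rw [real_inner_self_eq_norm_sq, hn]; norm_num
  have hx'n : ⟪n, x'⟫ = a + (a - ⟪n, x⟫) := by
    rw [hx', inner_add_right, inner_smul_right, hnn]; ring
  have ux' : u x' = 0 := by
    by_contra h
    have := hs x' (subset_tsupport u h)
    linarith
  have lim := ((approx_id hu.continuous hc x).sub (approx_id hu.continuous hc x'))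
  rw [ux', mul_zero, sub_zero] at lim
  refine le_of_tendsto (ENNReal.tendsto_ofReal lim) ?_
  filter_upwards [Filter.eventually_gt_atTop (0:ℝ)] with l hl
  have rep : ∀ p : E3, ∫ z, pk l (‖z - p‖ ^ 2) * u z = ∫ z, gam l (‖z - p‖ ^ 2) * (- lap u z) := by
    intro p
    have cd : ContDiff ℝ 2 (fun z : E3 => gam l (‖z - p‖ ^ 2)) :=
      (contDiff_gam l).comp (contDiff_id.sub contDiff_const)
    have := green cd hu hc
    simp only [mul_neg, integral_neg]
    rw [this, ← integral_neg]
    congr 1; ext z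
    rw [lap_comp_sub (fun z : E3 => gam l (‖z‖ ^ 2)) p z, lap_gam]; ring
  have int : ∀ p : E3, Integrable (fun z => gam l (‖z - p‖ ^ 2) * (- lap u z)) := by
    intro p
    have cd : Continuous (fun z : E3 => gam l (‖z - p‖ ^ 2)) :=
      ((contDiff_gam l).comp (contDiff_id.sub contDiff_const)).continuous
    refine (cd.mul (continuous_lap hu).neg).integrable_of_hasCompactSupport ?_
    exact (hcs_lap hc).neg.mul_left
  rw [rep, rep, ← integral_sub (int x) (int x')]
  refine (ofReal_integral_le ((int x).sub (int x'))).trans ?_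
  refine lintegral_mono_ae ?_
  filter_upwards [ae_ne_pt x] with y hy
  by_cases hyt : y ∈ tsupport u
  · have hya := hs y hyt
    set dx := a - ⟪n, x⟫ with hdx
    set dy := a - ⟪n, y⟫ with hdy
    have dxp : 0 < dx := by linarith
    have dyp : 0 < dy := by linarith
    have hA : 0 < ‖y - x‖ ^ 2 := by have := norm_pos_iff.2 (sub_ne_zero.2 hy); positivity
    have hB : ‖y - x'‖ ^ 2 = ‖y - x‖ ^ 2 + 4 * dx * dy := by
      have : y - x' = (y - x) - (2 * dx) • n := by rw [hx']; abel
      rw [this, norm_sub_sq_real, norm_smul, hn, inner_smul_right, real_inner_comm, inner_sub_right,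
        mul_one, Real.norm_eq_abs, sq_abs]
      have e1 : ⟪n, y⟫ = a - dy := by rw [hdy]; ring
      have e2 : ⟪n, x⟫ = a - dx := by rw [hdx]; ring
      rw [e1, e2]; ring
    have hS : dx + dy ≤ ‖y - x'‖ := by
      have h1 := abs_real_inner_le_norm n (x' - y)
      rw [hn, one_mul, inner_sub_right, hx'n, norm_sub_rev] at h1
      have h2 := le_abs_self (a + dx - ⟪n, y⟫)
      linarith
    have hmin : gam l (‖y - x‖ ^ 2) - gam l (‖y - x'‖ ^ 2) ≤ 2 * min dx dy / ‖y - x‖ ^ 2 := by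
      rcases le_total dx dy with h | h
      · rw [min_eq_left h]
        exact gam_diff hl hA dxp.le dyp.le hB (by gcongr; linarith)
      · rw [min_eq_right h]
        exact gam_diff hl hA dyp.le dxp.le (by rw [hB]; ring) (by gcongr; linarith)
    have hpos : 0 ≤ gam l (‖y - x‖ ^ 2) - gam l (‖y - x'‖ ^ 2) :=
      sub_nonneg.2 (gam_anti hl hA.le (by rw [hB]; nlinarith [mul_pos dxp dyp]))
    rw [kap_eq (sub_ne_zero.2 hy.symm), norm_sub_rev x y]
    simp only [Pi.sub_apply]
    rw [show gam l (‖y - x‖ ^ 2) * -lap u y - gam l (‖y - x'‖ ^ 2) * -lap u y =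
      (gam l (‖y - x‖ ^ 2) - gam l (‖y - x'‖ ^ 2)) * (-lap u y) by ring,
      ENNReal.ofReal_mul hpos, ← ENNReal.ofReal_mul (p := 2 * min dx dy) (by positivity),
      ← div_eq_mul_inv]
    exact mul_le_mul' (ENNReal.ofReal_le_ofReal hmin) (hg y)
  · have : lap u y = 0 := by
      have h0 : u =ᶠ[nhds y] fun _ => 0 := notMem_tsupport_iff_eventuallyEq.1 hyt
      rw [lap_congr h0]; simp [lap]
    simp [this]

def bet (t : ℝ) : ℝ := ∫ s in (0:ℝ)..t, Real.smoothTransition s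

theorem hd_bet (t : ℝ) : HasDerivAt bet (Real.smoothTransition t) t :=
  (Real.smoothTransition.continuous.integral_hasStrictDerivAt 0 t).hasDerivAt

theorem hd_st (t : ℝ) : HasDerivAt Real.smoothTransition (deriv Real.smoothTransition t) t :=
  (Real.smoothTransition.contDiff (n := 1)).differentiable (by norm_num) t |>.hasDerivAt

theorem st_deriv_nonneg (t : ℝ) : 0 ≤ deriv Real.smoothTransition t :=
  Real.smoothTransition.monotone.deriv_nonneg

theorem contDiff_bet : ContDiff ℝ 2 bet := by
  rw [show (2 : WithTop ℕ∞) = 1 + 1 by norm_num, contDiff_succ_iff_deriv]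
  refine ⟨fun t => (hd_bet t).differentiableAt, by simp, ?_⟩
  rw [show deriv bet = Real.smoothTransition from funext fun t => (hd_bet t).deriv]
  exact Real.smoothTransition.contDiff (n := 1)

theorem bet_nonpos {t : ℝ} (ht : t ≤ 0) : bet t = 0 := by
  unfold bet
  rw [intervalIntegral.integral_symm, intervalIntegral.integral_congr (g := fun _ => 0)]
  · simp
  · intro s hs
    rw [uIcc_of_le ht] at hs
    exact Real.smoothTransition.zero_of_nonpos hs.2

theorem bet_ge (t : ℝ) : t - 1 ≤ bet t := by
  have mono : Monotone bet := monotone_of_deriv_nonneg (fun t => (hd_bet t).differentiableAt)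
    fun t => by rw [(hd_bet t).deriv]; exact Real.smoothTransition.nonneg t
  rcases le_total t 1 with h | h
  · rcases le_total t 0 with h0 | h0
    · rw [bet_nonpos h0]; linarith
    · have := mono h0
      rw [bet_nonpos le_rfl] at this; linarith
  · have h1 : bet t - bet 1 = t - 1 := by
      unfold bet
      rw [intervalIntegral.integral_interval_sub_left
        (Real.smoothTransition.continuous.intervalIntegrable _ _)
        (Real.smoothTransition.continuous.intervalIntegrable _ _),
        intervalIntegral.integral_congr (g := fun _ => 1)]
      · simp
      · intro s hs
        rw [uIcc_of_le h] at hs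
        exact Real.smoothTransition.one_of_one_le hs.1
    have := mono (show (0:ℝ) ≤ 1 by norm_num)
    rw [bet_nonpos le_rfl] at this
    linarith

theorem pd_mul {f g : E3 → ℝ} {x : E3} (j : Fin 3) (hf : DifferentiableAt ℝ f x)
    (hg : DifferentiableAt ℝ g x) :
    pd j (fun y : E3 => f y * g y) x = f x * pd j g x + pd j f x * g x := by
  unfold pd
  have h2 : HasFDerivAt (fun y : E3 => f y * g y) _ x := hf.hasFDerivAt.mul hg.hasFDerivAt
  rw [h2.fderiv]; simp; ring

theorem pd_comp {B : ℝ → ℝ} {b : ℝ} {w : E3 → ℝ} {x : E3} (j : Fin 3)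
    (hB : HasDerivAt B b (w x)) (hw : DifferentiableAt ℝ w x) :
    pd j (fun y => B (w y)) x = b * pd j w x := by
  unfold pd
  have h2 : HasFDerivAt (fun y : E3 => B (w y)) _ x := hB.comp_hasFDerivAt x hw.hasFDerivAt
  rw [h2.fderiv]; simp

theorem lap_comp {B B1 B2 : ℝ → ℝ} (h1 : ∀ t, HasDerivAt B (B1 t) t)
    (h2 : ∀ t, HasDerivAt B1 (B2 t) t) {w : E3 → ℝ} {x : E3} (hw : ContDiffAt ℝ 2 w x) :
    lap (fun y => B (w y)) x = B2 (w x) * ∑ i, pd i w x ^ 2 + B1 (w x) * lap w x := by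
  simp only [lap_eq]
  have ev : ∀ᶠ y in nhds x, DifferentiableAt ℝ w y := by
    filter_upwards [hw.eventually (by simp)] with y hy
    exact hy.differentiableAt (by norm_num)
  rw [Finset.mul_sum, Finset.mul_sum, ← Finset.sum_add_distrib]
  refine Finset.sum_congr rfl fun i _ => ?_
  have e : pd i (fun y => B (w y)) =ᶠ[nhds x] fun y => B1 (w y) * pd i w y := by
    filter_upwards [ev] with y hy using pd_comp i (h1 _) hy
  have dw := hw.differentiableAt (by norm_num)
  have d1 : DifferentiableAt ℝ (fun y => B1 (w y)) x :=
    ((h2 _).comp_hasFDerivAt x dw.hasFDerivAt).differentiableAt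
  rw [pd_congr e, pd_mul i d1 ((contDiffAt_pd hw i).differentiableAt (by norm_num)),
    pd_comp i (h2 _) dw]
  ring

theorem compar {U : Set E3} (hU : IsOpen U) {w : E3 → ℝ} (hw : ContDiffOn ℝ 2 w U)
    (hK : ∀ ε > 0, IsCompact {x | x ∈ U ∧ ε ≤ w x})
    {n : E3} (hn : ‖n‖ = 1) {a : ℝ} (hs : ∀ y ∈ U, ⟪n, y⟫ < a)
    {g : E3 → ℝ≥0∞} (hg : ∀ y ∈ U, ENNReal.ofReal (- lap w y) ≤ g y) {x : E3} (hx : x ∈ U) :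
    ENNReal.ofReal (c0 * w x) ≤
      ∫⁻ y, ENNReal.ofReal (2 * min (a - ⟪n, x⟫) (a - ⟪n, y⟫)) * kap (x - y) * g y := by
  classical
  have main : ∀ ε > 0, ENNReal.ofReal (c0 * (w x - 2 * ε)) ≤
      ∫⁻ y, ENNReal.ofReal (2 * min (a - ⟪n, x⟫) (a - ⟪n, y⟫)) * kap (x - y) * g y := by
    intro ε hε
    set B : ℝ → ℝ := fun t => ε * bet ((t - ε) / ε) with hB
    set B1 : ℝ → ℝ := fun t => Real.smoothTransition ((t - ε) / ε) with hB1
    set B2 : ℝ → ℝ := fun t => deriv Real.smoothTransition ((t - ε) / ε) / ε with hB2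
    have aff : ∀ t, HasDerivAt (fun t : ℝ => (t - ε) / ε) (1 / ε) t := fun t =>
      ((hasDerivAt_id t).sub_const ε).div_const ε
    have H1 : ∀ t, HasDerivAt B (B1 t) t := by
      intro t
      refine (((hd_bet _).comp t (aff t)).const_mul ε).congr_deriv ?_
      simp only [hB1]; field_simp
    have H2 : ∀ t, HasDerivAt B1 (B2 t) t := by
      intro t
      refine ((hd_st _).comp t (aff t)).congr_deriv ?_
      simp only [hB2]; field_simp
    have cB : ContDiff ℝ 2 B := by
      refine contDiff_const.mul (contDiff_bet.comp ?_)
      exact (contDiff_id.sub contDiff_const).div_const ε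
    set u : E3 → ℝ := U.indicator (fun y => B (w y)) with hu
    set K := {x | x ∈ U ∧ ε ≤ w x} with hKd
    have uU : ∀ y ∈ U, u =ᶠ[nhds y] fun y => B (w y) := by
      intro y hy
      filter_upwards [hU.mem_nhds hy] with z hz
      simp [hu, hz]
    have u0 : ∀ y, y ∉ K → u y = 0 := by
      intro y hy
      by_cases hyU : y ∈ U
      · have : w y < ε := by
          by_contra h; exact hy ⟨hyU, not_lt.1 h⟩
        simp only [hu, indicator_of_mem hyU, hB]
        rw [bet_nonpos (div_nonpos_of_nonpos_of_nonneg (by linarith) hε.le), mul_zero]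
      · simp [hu, hyU]
    have tK : tsupport u ⊆ K := by
      refine closure_minimal ?_ (hK ε hε).isClosed
      intro y hy
      by_contra h; exact hy (u0 y h)
    have cu : ContDiff ℝ 2 u := by
      rw [contDiff_iff_contDiffAt]
      intro y
      by_cases hyU : y ∈ U
      · exact ((cB.contDiffAt).comp y (hw.contDiffAt (hU.mem_nhds hyU))).congr_of_eventuallyEq (uU y hyU)
      · have : y ∉ tsupport u := fun h => hyU (tK h).1
        exact contDiffAt_const.congr_of_eventuallyEq (notMem_tsupport_iff_eventuallyEq.1 this)
    have hc : HasCompactSupport u := (hK ε hε).of_isClosed_subset (isClosed_tsupport u) tK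
    have fin := upper cu hc hn (fun y hy => hs y (tK hy).1) (g := g) ?_ (hs x hx)
    · refine le_trans (ENNReal.ofReal_le_ofReal ?_) fin
      refine mul_le_mul_of_nonneg_left ?_ c0_pos.le
      rw [(uU x hx).eq_of_nhds]
      simp only [hB]
      have := mul_le_mul_of_nonneg_left (bet_ge ((w x - ε) / ε)) hε.le
      have e : ε * ((w x - ε) / ε - 1) = w x - 2 * ε := by field_simp; ring
      linarith
    · intro y
      by_cases hyU : y ∈ U
      · rw [lap_congr (uU y hyU), lap_comp H1 H2 (hw.contDiffAt (hU.mem_nhds hyU))]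
        refine le_trans ?_ (hg y hyU)
        have n1 : 0 ≤ B2 (w y) * ∑ i, pd i w y ^ 2 :=
          mul_nonneg (div_nonneg (st_deriv_nonneg _) hε.le) (Finset.sum_nonneg fun i _ => sq_nonneg _)
        have n2 : 0 ≤ B1 (w y) := Real.smoothTransition.nonneg _
        have n3 : B1 (w y) ≤ 1 := Real.smoothTransition.le_one _
        rcases le_total 0 (- lap w y) with h | h
        · apply ENNReal.ofReal_le_ofReal
          nlinarith
        · rw [ENNReal.ofReal_of_nonpos]
          · exact zero_le
          · nlinarith
      · have : y ∉ tsupport u := fun h => hyU (tK h).1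
        have h0 : u =ᶠ[nhds y] fun _ => 0 := notMem_tsupport_iff_eventuallyEq.1 this
        rw [lap_congr h0]; simp [lap]
  have lim : Filter.Tendsto (fun ε : ℝ => ENNReal.ofReal (c0 * (w x - 2 * ε))) (nhdsWithin 0 (Ioi 0))
      (nhds (ENNReal.ofReal (c0 * (w x - 2 * 0)))) := by
    refine ENNReal.tendsto_ofReal (Filter.Tendsto.mono_left ?_ nhdsWithin_le_nhds)
    exact Continuous.tendsto (by fun_prop) 0
  simp only [mul_zero, sub_zero] at lim
  refine le_of_tendsto lim ?_
  filter_upwards [self_mem_nhdsWithin] with ε hε using main ε hε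

theorem st_bounds : ∃ A : ℝ, 0 < A ∧ (∀ t, |deriv Real.smoothTransition t| ≤ A) ∧
    ∀ t, |deriv (deriv Real.smoothTransition) t| ≤ A := by
  have d1 : ContDiff ℝ 1 (deriv Real.smoothTransition) := by
    have := (Real.smoothTransition.contDiff (n := 2))
    exact ContDiff.deriv' (n := 1) (by norm_num; exact this)
  have d0 : Continuous (deriv (deriv Real.smoothTransition)) := d1.continuous_deriv (by norm_num)
  have z1 : ∀ t, t ∉ Icc (0:ℝ) 1 → deriv Real.smoothTransition =ᶠ[nhds t] fun _ => 0 := by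
    intro t ht
    have : ∀ᶠ s in nhds t, s ∉ Icc (0:ℝ) 1 := isClosed_Icc.isOpen_compl.mem_nhds ht
    filter_upwards [this.eventually_nhds] with s hs
    have hs' := hs.self_of_nhds
    rcases lt_or_ge s 0 with h | h
    · have : Real.smoothTransition =ᶠ[nhds s] fun _ => 0 := by
        filter_upwards [gt_mem_nhds h] with r hr using Real.smoothTransition.zero_of_nonpos hr.le
      rw [this.deriv_eq]; simp
    · have h1 : 1 < s := by
        by_contra h1; exact hs' ⟨h, not_lt.1 h1⟩
      have : Real.smoothTransition =ᶠ[nhds s] fun _ => 1 := by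
        filter_upwards [lt_mem_nhds h1] with r hr using Real.smoothTransition.one_of_one_le hr.le
      rw [this.deriv_eq]; simp
  obtain ⟨A1, h1⟩ := isCompact_Icc.exists_bound_of_continuousOn (s := Icc (0:ℝ) 1) d1.continuous.continuousOn
  obtain ⟨A2, h2⟩ := isCompact_Icc.exists_bound_of_continuousOn (s := Icc (0:ℝ) 1) d0.continuousOn
  refine ⟨max 1 (max A1 A2), by positivity, fun t => ?_, fun t => ?_⟩
  · by_cases ht : t ∈ Icc (0:ℝ) 1
    · exact (h1 t ht).trans ((le_max_left _ _).trans (le_max_right _ _))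
    · rw [(z1 t ht).eq_of_nhds]; simp
  · by_cases ht : t ∈ Icc (0:ℝ) 1
    · exact (h2 t ht).trans ((le_max_right _ _).trans (le_max_right _ _))
    · rw [(z1 t ht).deriv_eq]; simp

theorem hd_st1 (t : ℝ) : HasDerivAt (deriv Real.smoothTransition)
    (deriv (deriv Real.smoothTransition) t) t := by
  have d1 : ContDiff ℝ 1 (deriv Real.smoothTransition) := by
    have := (Real.smoothTransition.contDiff (n := 2))
    exact ContDiff.deriv' (n := 1) (by norm_num; exact this)
  exact (d1.differentiable (by norm_num) t).hasDerivAt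

def cX (r t : ℝ) : ℝ := Real.smoothTransition (4 / 3 * (1 - t / r ^ 2))
def cX1 (r t : ℝ) : ℝ := -(4 / (3 * r ^ 2)) * deriv Real.smoothTransition (4 / 3 * (1 - t / r ^ 2))
def cX2 (r t : ℝ) : ℝ :=
  (16 / (9 * r ^ 4)) * deriv (deriv Real.smoothTransition) (4 / 3 * (1 - t / r ^ 2))

theorem aff_hd (r t : ℝ) :
    HasDerivAt (fun t : ℝ => 4 / 3 * (1 - t / r ^ 2)) (-(4 / (3 * r ^ 2))) t := by
  refine ((((hasDerivAt_id t).div_const (r ^ 2)).const_sub 1).const_mul (4 / 3)).congr_deriv ?_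
  ring

theorem hd_cX (r t : ℝ) : HasDerivAt (cX r) (cX1 r t) t := by
  refine HasDerivAt.congr_deriv (f := cX r) ((hd_st _).comp t (aff_hd r t)) ?_
  unfold cX1; ring

theorem hd_cX1 (r t : ℝ) : HasDerivAt (cX1 r) (cX2 r t) t := by
  refine HasDerivAt.congr_deriv (f := cX1 r)
    (((hd_st1 _).comp t (aff_hd r t)).const_mul (-(4 / (3 * r ^ 2)))) ?_
  unfold cX2; ring

theorem contDiff_cX (r : ℝ) : ContDiff ℝ 2 (fun z : E3 => cX r (‖z‖ ^ 2)) := by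
  refine (Real.smoothTransition.contDiff (n := 2)).comp ?_
  exact contDiff_const.mul (contDiff_const.sub ((contDiff_norm_sq ℝ).div_const _))

theorem cX_one {r t : ℝ} (hr : 0 < r) (ht : t ≤ r ^ 2 / 4) : cX r t = 1 := by
  apply Real.smoothTransition.one_of_one_le
  have : t / r ^ 2 ≤ 1 / 4 := by rw [div_le_iff₀ (by positivity)]; linarith
  linarith

theorem cX_zero {r t : ℝ} (hr : 0 < r) (ht : r ^ 2 ≤ t) : cX r t = 0 := by
  apply Real.smoothTransition.zero_of_nonpos
  have : 1 ≤ t / r ^ 2 := by rw [le_div_iff₀ (by positivity)]; linarith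
  linarith

theorem cX_ev {r t : ℝ} (hr : 0 < r) (ht : t < r ^ 2 / 4 ∨ r ^ 2 < t) :
    cX1 r t = 0 ∧ cX2 r t = 0 := by
  have key : ∃ c : ℝ, cX r =ᶠ[nhds t] fun _ => c := by
    rcases ht with h | h
    · exact ⟨1, by filter_upwards [gt_mem_nhds h] with s hs using cX_one hr hs.le⟩
    · exact ⟨0, by filter_upwards [lt_mem_nhds h] with s hs using cX_zero hr hs.le⟩
  obtain ⟨c, hc⟩ := key
  have h1 : cX1 r =ᶠ[nhds t] fun _ => 0 := by
    filter_upwards [hc.eventuallyEq_nhds] with s hs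
    rw [← (hd_cX r s).deriv, hs.deriv_eq]; simp
  refine ⟨h1.eq_of_nhds, ?_⟩
  rw [← (hd_cX1 r t).deriv, h1.deriv_eq]; simp

theorem pw_le {l s : ℝ} (hl : 0 < l) (hs : 0 < s) (k : ℕ) :
    (1 + l ^ 2 * s ^ 2) ^ (-(k : ℝ) / 2) ≤ ((l * s) ^ k)⁻¹ := by
  calc (1 + l ^ 2 * s ^ 2) ^ (-(k : ℝ) / 2) ≤ ((l * s) ^ 2) ^ (-(k : ℝ) / 2) :=
        Real.rpow_le_rpow_of_nonpos (by positivity) (by nlinarith) (by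
          have : (0:ℝ) ≤ k := k.cast_nonneg
          linarith)
    _ = _ := by
        rw [← Real.rpow_natCast (l * s) 2, ← Real.rpow_mul (by positivity),
          ← Real.rpow_natCast, ← Real.rpow_neg (by positivity)]
        congr 1; push_cast; ring

theorem ph_bd {l s : ℝ} (hl : 0 < l) (hs : 0 < s) : |ph l (s ^ 2)| ≤ (s ^ 3)⁻¹ := by
  have := pw_le hl hs 3
  unfold ph
  rw [abs_mul, abs_neg, abs_of_pos (by positivity), abs_of_nonneg (by positivity)]
  calc l ^ 3 * (1 + l ^ 2 * s ^ 2) ^ (-3 / 2 : ℝ) ≤ l ^ 3 * ((l * s) ^ 3)⁻¹ := by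
        gcongr; exact_mod_cast this
    _ = _ := by field_simp

theorem ph1_bd {l s : ℝ} (hl : 0 < l) (hs : 0 < s) : |ph1 l (s ^ 2)| ≤ 3 / 2 * (s ^ 5)⁻¹ := by
  have := pw_le hl hs 5
  unfold ph1
  rw [abs_of_nonneg (by positivity)]
  calc 3 / 2 * l ^ 5 * (1 + l ^ 2 * s ^ 2) ^ (-5 / 2 : ℝ) ≤ 3 / 2 * l ^ 5 * ((l * s) ^ 5)⁻¹ := by
        gcongr; exact_mod_cast this
    _ = _ := by field_simp

theorem coord_le (z : E3) (i : Fin 3) : |z i| ≤ ‖z‖ := by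
  simpa using PiLp.norm_apply_le z i

/-- error kernel -/
def eK (r l : ℝ) (i : Fin 3) (z : E3) : ℝ :=
  z i * (ph l (‖z‖ ^ 2) * (10 * cX1 r (‖z‖ ^ 2) + 4 * ‖z‖ ^ 2 * cX2 r (‖z‖ ^ 2))
    + 8 * ‖z‖ ^ 2 * ph1 l (‖z‖ ^ 2) * cX1 r (‖z‖ ^ 2))

theorem eK_bd {A : ℝ} (hA : 0 < A) (h1 : ∀ t, |deriv Real.smoothTransition t| ≤ A)
    (h2 : ∀ t, |deriv (deriv Real.smoothTransition) t| ≤ A) {r l : ℝ} (hr : 0 < r) (hl : 0 < l)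
    (i : Fin 3) (z : E3) (hz : ‖z‖ ≤ r) : |eK r l i z| ≤ 1000 * A * r⁻¹ ^ 4 := by
  unfold eK
  rcases lt_or_ge (‖z‖ ^ 2) (r ^ 2 / 4) with h | h
  · obtain ⟨e1, e2⟩ := cX_ev hr (Or.inl h)
    rw [e1, e2]; simp; positivity
  · set s := ‖z‖ with hs
    have hs0 : r / 2 ≤ s := by
      by_contra hh
      push Not at hh
      have : s ^ 2 < (r / 2) ^ 2 := by gcongr
      nlinarith
    have sp : 0 < s := by linarith
    have b1 : |ph l (s ^ 2)| ≤ 8 * r⁻¹ ^ 3 := by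
      refine (ph_bd hl sp).trans ?_
      calc (s ^ 3)⁻¹ ≤ ((r / 2) ^ 3)⁻¹ := by gcongr
        _ = _ := by field_simp; norm_num
    have b2 : |ph1 l (s ^ 2)| ≤ 48 * r⁻¹ ^ 5 := by
      refine (ph1_bd hl sp).trans ?_
      calc 3 / 2 * (s ^ 5)⁻¹ ≤ 3 / 2 * ((r / 2) ^ 5)⁻¹ := by gcongr
        _ = _ := by field_simp; norm_num
    have b3 : |cX1 r (s ^ 2)| ≤ 2 * A * r⁻¹ ^ 2 := by
      unfold cX1
      rw [abs_mul, abs_neg, abs_of_pos (by positivity : 0 < 4 / (3 * r ^ 2))]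
      calc 4 / (3 * r ^ 2) * _ ≤ 4 / (3 * r ^ 2) * A := by gcongr; exact h1 _
        _ = 4 / 3 * A * r⁻¹ ^ 2 := by field_simp
        _ ≤ _ := by gcongr; norm_num
    have b4 : |cX2 r (s ^ 2)| ≤ 2 * A * r⁻¹ ^ 4 := by
      unfold cX2
      rw [abs_mul, abs_of_pos (by positivity : 0 < 16 / (9 * r ^ 4))]
      calc 16 / (9 * r ^ 4) * _ ≤ 16 / (9 * r ^ 4) * A := by gcongr; exact h2 _
        _ = 16 / 9 * A * r⁻¹ ^ 4 := by field_simp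
        _ ≤ _ := by gcongr; norm_num
    have b5 : |10 * cX1 r (s ^ 2) + 4 * s ^ 2 * cX2 r (s ^ 2)| ≤ 28 * A * r⁻¹ ^ 2 := by
      calc _ ≤ |10 * cX1 r (s ^ 2)| + |4 * s ^ 2 * cX2 r (s ^ 2)| := abs_add_le _ _
        _ = 10 * |cX1 r (s ^ 2)| + 4 * s ^ 2 * |cX2 r (s ^ 2)| := by
            rw [abs_mul, abs_mul, abs_of_pos (by norm_num : (0:ℝ) < 10),
              abs_of_pos (by positivity : 0 < 4 * s ^ 2)]
        _ ≤ 10 * (2 * A * r⁻¹ ^ 2) + 4 * r ^ 2 * (2 * A * r⁻¹ ^ 4) := by gcongr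
        _ = _ := by field_simp; norm_num
    rw [abs_mul]
    calc |z i| * _ ≤ r * (8 * r⁻¹ ^ 3 * (28 * A * r⁻¹ ^ 2)
            + 8 * r ^ 2 * (48 * r⁻¹ ^ 5) * (2 * A * r⁻¹ ^ 2)) := by
          refine mul_le_mul ((coord_le z i).trans hz) ?_ (abs_nonneg _) hr.le
          refine (abs_add_le _ _).trans (add_le_add ?_ ?_)
          · rw [abs_mul]; gcongr
          · rw [abs_mul, abs_mul, abs_of_pos (by positivity : 0 < 8 * s ^ 2)]
            gcongr
      _ = 992 * (A * r⁻¹ ^ 4) := by field_simp; norm_num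
      _ ≤ 1000 * (A * r⁻¹ ^ 4) := by gcongr; norm_num
      _ = _ := by ring

theorem eK_zero {r l : ℝ} (hr : 0 < r) (i : Fin 3) (z : E3) (hz : r < ‖z‖) : eK r l i z = 0 := by
  obtain ⟨e1, e2⟩ := cX_ev (t := ‖z‖ ^ 2) hr (Or.inr (by gcongr))
  unfold eK; rw [e1, e2]; simp

theorem grad0 : ∃ C : ℝ, 0 < C ∧ ∀ (u : E3 → ℝ), ContDiff ℝ 2 u → HasCompactSupport u →
    ∀ r : ℝ, 0 < r → ∀ i : Fin 3, ‖pd i u 0‖ₑ ≤ ENNReal.ofReal C *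
      ((∫⁻ z in closedBall (0:E3) r, kap z * ‖lap u z‖ₑ) +
        ENNReal.ofReal (r⁻¹ ^ 4) * ∫⁻ z in closedBall (0:E3) r, ‖u z‖ₑ) := by
  obtain ⟨A, hA, hA1, hA2⟩ := st_bounds
  have hc0 := c0_pos
  refine ⟨(1 + 1000 * A) / c0, by positivity, fun u hu hc r hr i => ?_⟩
  set X : E3 → ℝ := fun z => cX r (‖z‖ ^ 2) with hX
  have cXX : ContDiff ℝ 2 X := contDiff_cX r
  have cXu : ContDiff ℝ 2 (fun z => X z * u z) := cXX.mul hu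
  have hcXu : HasCompactSupport (fun z => X z * u z) := hc.mul_left
  have X0 : X =ᶠ[nhds 0] fun _ => 1 := by
    have : ∀ᶠ z : E3 in nhds 0, ‖z‖ ^ 2 < r ^ 2 / 4 := by
      have := (continuous_norm.pow 2).continuousAt (x := (0:E3))
      refine this.eventually_lt_const ?_
      simp; positivity
    filter_upwards [this] with z hz using cX_one hr hz.le
  have p0 : pd i (fun z => X z * u z) 0 = pd i u 0 := by
    apply pd_congr
    filter_upwards [X0] with z hz
    rw [hz, one_mul]
  have lim := approx_id (h := pd i (fun z => X z * u z))
    (contDiff_pd (n := 1) (by norm_num; exact cXu) i).continuous (hcs_pd hcXu i) 0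
  rw [p0] at lim
  simp only [sub_zero] at lim
  have bound : ∀ l : ℝ, 0 < l → ‖∫ z : E3, pk l (‖z‖ ^ 2) * pd i (fun z => X z * u z) z‖ₑ ≤
      (∫⁻ z in closedBall (0:E3) r, kap z * ‖lap u z‖ₑ) +
        ENNReal.ofReal (1000 * A * r⁻¹ ^ 4) * ∫⁻ z in closedBall (0:E3) r, ‖u z‖ₑ := by
    intro l hl
    set Φ : E3 → ℝ := fun z => z i * (ph l (‖z‖ ^ 2) * X z) with hΦ
    have cΦ : ContDiff ℝ 2 Φ :=
      (EuclideanSpace.proj i : E3 →L[ℝ] ℝ).contDiff.mul ((contDiff_ph l).mul cXX)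
    have lapΦ : ∀ z, lap Φ z = - (pd i (fun z : E3 => pk l (‖z‖ ^ 2)) z * X z) + eK r l i z := by
      intro z
      have := lap_coord_rad (h := fun t => ph l t * cX r t)
        (h1 := fun t => ph1 l t * cX r t + ph l t * cX1 r t)
        (h2 := fun t => ph2 l t * cX r t + ph1 l t * cX1 r t + (ph1 l t * cX1 r t + ph l t * cX2 r t))
        (isOpen_S l) (fun t ht => (hd_ph l t ht).mul (hd_cX r t))
        (fun t ht => ((hd_ph1 l t ht).mul (hd_cX r t)).add ((hd_ph l t ht).mul (hd_cX1 r t)))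
        i (x := z) (mem_S l (by positivity))
      rw [show lap Φ z = _ from this, pd_rad i (hd_pk l _ (mem_S l (by positivity)))]
      have e := ph_id l (‖z‖ ^ 2) (by positivity)
      unfold eK
      simp only [hX]
      linear_combination (z i * cX r (‖z‖ ^ 2)) * e
    have ceK : Continuous (eK r l i) := by
      have : eK r l i = fun z => lap Φ z + pd i (fun z : E3 => pk l (‖z‖ ^ 2)) z * X z := by
        ext z; rw [lapΦ]; ring
      rw [this]
      exact (continuous_lap cΦ).add ((contDiff_pd (n := 1) (by norm_num; exact contDiff_pk l) i).continuous.mul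
        cXX.continuous)
    have i1 : Integrable (fun z => Φ z * lap u z) :=
      (cΦ.continuous.mul (continuous_lap hu)).integrable_of_hasCompactSupport (hcs_lap hc).mul_left
    have i2 : Integrable (fun z => eK r l i z * u z) :=
      (ceK.mul hu.continuous).integrable_of_hasCompactSupport hc.mul_left
    have id1 : ∫ z : E3, pk l (‖z‖ ^ 2) * pd i (fun z => X z * u z) z =
        (∫ z, Φ z * lap u z) - ∫ z, eK r l i z * u z := by
      rw [int_pd ((contDiff_pk l).of_le (by norm_num)) (cXu.of_le (by norm_num)) hcXu i,
        green cΦ hu hc, ← integral_sub, ← integral_neg]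
      · congr 1; ext z; rw [lapΦ]; ring
      · exact ((continuous_lap cΦ).mul hu.continuous).integrable_of_hasCompactSupport hc.mul_left
      · exact i2
    rw [id1]
    refine (enorm_sub_le).trans (add_le_add ?_ ?_)
    · refine (enorm_integral_le_lintegral_enorm _).trans ?_
      rw [← lintegral_indicator isClosed_closedBall.measurableSet]
      refine lintegral_mono fun z => ?_
      by_cases hz : z ∈ closedBall (0:E3) r
      · rw [indicator_of_mem hz, enorm_mul]
        gcongr
        by_cases z0 : z = 0
        · simp [hΦ, z0]
        · rw [kap_eq z0, Real.enorm_eq_ofReal_abs]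
          apply ENNReal.ofReal_le_ofReal
          have zp : 0 < ‖z‖ := norm_pos_iff.2 z0
          simp only [hΦ, hX]
          rw [abs_mul, abs_mul]
          have x1 : |cX r (‖z‖ ^ 2)| ≤ 1 := by
            unfold cX
            rw [abs_of_nonneg (Real.smoothTransition.nonneg _)]
            exact Real.smoothTransition.le_one _
          calc |z i| * (|ph l (‖z‖ ^ 2)| * |cX r (‖z‖ ^ 2)|) ≤ ‖z‖ * ((‖z‖ ^ 3)⁻¹ * 1) := by
                gcongr
                · exact coord_le z i
                · exact ph_bd hl zp
            _ = _ := by field_simp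
      · have : X z = 0 := cX_zero hr (by
          simp only [mem_closedBall, dist_zero_right, not_le] at hz
          gcongr)
        simp [hΦ, this, hz]
    · refine (enorm_integral_le_lintegral_enorm _).trans ?_
      rw [← lintegral_const_mul' _ _ ENNReal.ofReal_ne_top,
        ← lintegral_indicator isClosed_closedBall.measurableSet]
      refine lintegral_mono fun z => ?_
      by_cases hz : z ∈ closedBall (0:E3) r
      · rw [indicator_of_mem hz, enorm_mul]
        gcongr
        rw [Real.enorm_eq_ofReal_abs]
        exact ENNReal.ofReal_le_ofReal (eK_bd hA hA1 hA2 hr hl i z (by simpa using hz))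
      · rw [eK_zero hr i z (by simpa using hz)]; simp
  have fin : ‖c0 * pd i u 0‖ₑ ≤ (∫⁻ z in closedBall (0:E3) r, kap z * ‖lap u z‖ₑ) +
        ENNReal.ofReal (1000 * A * r⁻¹ ^ 4) * ∫⁻ z in closedBall (0:E3) r, ‖u z‖ₑ := by
    refine le_of_tendsto lim.enorm ?_
    filter_upwards [Filter.eventually_gt_atTop (0:ℝ)] with l hl using bound l hl
  have e : ‖pd i u 0‖ₑ = ENNReal.ofReal (c0⁻¹) * ‖c0 * pd i u 0‖ₑ := by
    rw [← ofReal_norm, ← ofReal_norm, ← ENNReal.ofReal_mul (by positivity), norm_mul,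
      Real.norm_of_nonneg hc0.le]
    congr 1; field_simp
  rw [e, div_eq_inv_mul, ENNReal.ofReal_mul (by positivity), mul_assoc]
  gcongr
  refine fin.trans ?_
  rw [mul_add]
  refine add_le_add ?_ ?_
  · refine le_mul_of_one_le_left (zero_le) ?_
    rw [← ENNReal.ofReal_one]
    exact ENNReal.ofReal_le_ofReal (by linarith)
  · rw [← mul_assoc, ← ENNReal.ofReal_mul (by positivity)]
    refine mul_le_mul_left (ENNReal.ofReal_le_ofReal ?_) _
    have : 0 < r⁻¹ ^ 4 := by positivity
    nlinarith

theorem setLInt_shift (x : E3) (r : ℝ) (f : E3 → ℝ≥0∞) :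
    ∫⁻ z in closedBall (0:E3) r, f (x + z) = ∫⁻ y in closedBall x r, f y := by
  have := (measurePreserving_add_left (volume : Measure E3) x).setLIntegral_comp_preimage_emb
    (measurableEmbedding_addLeft x) f (closedBall x r)
  rw [← this]
  congr 2
  ext z; simp [dist_eq_norm]

theorem gradX : ∃ C : ℝ, 0 < C ∧ ∀ (Ω : Set E3) (v : E3 → ℝ), IsOpen Ω → ContDiffOn ℝ 2 v Ω →
    ∀ (x : E3) (r : ℝ), 0 < r → ball x (2 * r) ⊆ Ω → ∀ i : Fin 3, ‖pd i v x‖ₑ ≤ ENNReal.ofReal C *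
      ((∫⁻ y in closedBall x r, kap (x - y) * ‖lap v y‖ₑ) +
        ENNReal.ofReal (r⁻¹ ^ 4) * ∫⁻ y in closedBall x r, ‖v y‖ₑ) := by
  obtain ⟨C, hC, H⟩ := grad0
  refine ⟨C, hC, fun Ω v hΩ hv x r hr hb i => ?_⟩
  let ζ : ContDiffBump x := ⟨5 / 4 * r, 3 / 2 * r, by positivity, by linarith⟩
  set V : E3 → ℝ := fun y => ζ y * v y with hV
  have VV : ∀ y ∈ closedBall x r, V =ᶠ[nhds y] v := by
    intro y hy
    have : y ∈ ball x ζ.rIn := by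
      have h : ζ.rIn = 5 / 4 * r := rfl
      rw [h, mem_ball]; rw [mem_closedBall] at hy; linarith
    filter_upwards [ζ.eventuallyEq_one_of_mem_ball this] with z hz
    simp [hV, hz]
  have sup : tsupport V ⊆ closedBall x (3 / 2 * r) := by
    refine (tsupport_mul_subset_left).trans ?_
    rw [ζ.tsupport_eq]
  have cV : ContDiff ℝ 2 V := by
    rw [contDiff_iff_contDiffAt]
    intro y
    by_cases hy : y ∈ ball x (2 * r)
    · exact ζ.contDiff.contDiffAt.mul (hv.contDiffAt (hΩ.mem_nhds (hb hy)))
    · have : y ∉ tsupport V := fun h => hy (by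
        have := sup h
        rw [mem_closedBall] at this; rw [mem_ball]; linarith)
      exact contDiffAt_const.congr_of_eventuallyEq (notMem_tsupport_iff_eventuallyEq.1 this)
  have hcV : HasCompactSupport V :=
    (isCompact_closedBall x (3 / 2 * r)).of_isClosed_subset (isClosed_tsupport V) sup
  have key := H (fun z => V (x + z)) (cV.comp (contDiff_const.add contDiff_id))
    (hcV.comp_homeomorph (Homeomorph.addLeft x)) r hr i
  simp only [lap_comp_add] at key
  rw [pd_comp_add i V x 0, add_zero, pd_congr (VV x (mem_closedBall_self hr.le))] at key
  refine key.trans (le_of_eq ?_)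
  congr 2
  · rw [← setLInt_shift x r]
    refine setLIntegral_congr_fun isClosed_closedBall.measurableSet fun z hz => ?_
    have hz' : x + z ∈ closedBall x r := by simpa [dist_eq_norm] using hz
    try simp only
    rw [lap_congr (VV _ hz')]
    simp [kap]
  · rw [← setLInt_shift x r]
    congr 1
    refine setLIntegral_congr_fun isClosed_closedBall.measurableSet fun z hz => ?_
    have hz' : x + z ∈ closedBall x r := by simpa [dist_eq_norm] using hz
    try simp only
    rw [(VV _ hz').eq_of_nhds]

theorem lint_scale {s : ℝ} (hs : 0 < s) (f : E3 → ℝ≥0∞) :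
    ∫⁻ z, f z = ENNReal.ofReal (s ^ 3) * ∫⁻ z, f (s • z) := by
  have h1 := (Homeomorph.smulOfNeZero s hs.ne').measurableEmbedding.lintegral_map f
    (μ := (volume : Measure E3))
  have h2 : Measure.map (Homeomorph.smulOfNeZero s hs.ne') (volume : Measure E3)
      = ENNReal.ofReal (s ^ 3)⁻¹ • volume := by
    have := Measure.map_addHaar_smul (volume : Measure E3) hs.ne'
    rw [finrank_euclideanSpace_fin, abs_of_pos (by positivity)] at this
    exact this
  rw [h2, lintegral_smul_measure] at h1
  have h3 : ∫⁻ z, f (s • z) = ENNReal.ofReal (s ^ 3)⁻¹ * ∫⁻ z, f z := h1.symm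
  rw [h3, ← mul_assoc, ← ENNReal.ofReal_mul (by positivity), mul_inv_cancel₀ (by positivity)]
  simp

theorem kap_symm (x y : E3) : kap (x - y) = kap (y - x) := by
  unfold kap; rw [← enorm_neg, neg_sub]

theorem measurable_kap : Measurable kap := by
  unfold kap; fun_prop

theorem kap_smul {s : ℝ} (hs : 0 < s) (z : E3) :
    kap (s • z) = ENNReal.ofReal ((s ^ 2)⁻¹) * kap z := by
  unfold kap
  rw [enorm_smul, mul_pow, ENNReal.mul_inv, Real.enorm_eq_ofReal hs.le,
    ENNReal.ofReal_inv_of_pos (by positivity), ENNReal.ofReal_pow hs.le]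
  · left; simp [hs.ne']
  · left; simp

theorem kap_int_one : ∫⁻ z in closedBall (0:E3) 1, kap z < ⊤ := by
  have h : IntegrableOn (fun x : E3 => (‖x‖ ^ 2)⁻¹) (ball (0 : E3) 2) := by
    rw [integrableOn_fun_norm_addHaar volume (f := fun t => (t ^ 2)⁻¹), finrank_euclideanSpace_fin]
    have : IntegrableOn (fun _ : ℝ => (1:ℝ)) (Ioo 0 2) := by simp
    refine this.congr_fun (fun t ht => ?_) measurableSet_Ioo
    have : t ≠ 0 := ht.1.ne'
    simp; field_simp
  have h2 := h.lintegral_lt_top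
  refine lt_of_le_of_lt ?_ h2
  calc ∫⁻ z in closedBall (0:E3) 1, kap z ≤ ∫⁻ z in ball (0:E3) 2, kap z :=
        lintegral_mono_set (closedBall_subset_ball (by norm_num))
    _ ≤ _ := by
        refine lintegral_mono_ae ?_
        filter_upwards [ae_restrict_of_ae (ae_ne_pt 0)] with z hz
        rw [kap_eq hz]

theorem kapI : ∃ I : ℝ, 0 < I ∧ ∀ s, 0 < s → ∀ x : E3,
    ∫⁻ y in closedBall x s, kap (x - y) ≤ ENNReal.ofReal (I * s) := by
  refine ⟨(∫⁻ z in closedBall (0:E3) 1, kap z).toReal + 1, by positivity, fun s hs x => ?_⟩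
  rw [← setLInt_shift, ← lintegral_indicator isClosed_closedBall.measurableSet, lint_scale hs]
  have : ∀ z : E3, (closedBall (0:E3) s).indicator (fun z => kap (x - (x + z))) (s • z)
      = ENNReal.ofReal ((s ^ 2)⁻¹) * (closedBall (0:E3) 1).indicator kap z := by
    intro z
    by_cases hz : z ∈ closedBall (0:E3) 1
    · have : s • z ∈ closedBall (0:E3) s := by
        simp only [mem_closedBall, dist_zero_right, norm_smul, Real.norm_of_nonneg hs.le] at *
        nlinarith
      rw [indicator_of_mem hz, indicator_of_mem this, ← kap_smul hs]
      have := kap_symm 0 (s • z)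
      simpa using this
    · have : s • z ∉ closedBall (0:E3) s := by
        simp only [mem_closedBall, dist_zero_right, norm_smul, Real.norm_of_nonneg hs.le,
          not_le] at *
        nlinarith
      rw [indicator_of_notMem hz, indicator_of_notMem this, mul_zero]
  simp only [this]
  rw [lintegral_const_mul _ (measurable_kap.indicator isClosed_closedBall.measurableSet),
    lintegral_indicator isClosed_closedBall.measurableSet, ← mul_assoc,
    ← ENNReal.ofReal_mul (by positivity), mul_comm (_ + 1) s, ENNReal.ofReal_mul hs.le]
  refine mul_le_mul' (ENNReal.ofReal_le_ofReal (le_of_eq (by field_simp))) ?_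
  rw [ENNReal.ofReal_add ENNReal.toReal_nonneg zero_le_one, ENNReal.ofReal_toReal kap_int_one.ne]
  exact le_self_add

theorem vol_cb : ∃ c : ℝ, 0 < c ∧ ∀ s, 0 < s → ∀ x : E3,
    volume (closedBall x s) ≤ ENNReal.ofReal (c * s ^ 3) := by
  refine ⟨(volume (ball (0:E3) 1)).toReal + 1, by positivity, fun s hs x => ?_⟩
  rw [Measure.addHaar_closedBall _ _ hs.le, finrank_euclideanSpace_fin, mul_comm (_ + 1),
    ENNReal.ofReal_mul (by positivity),
    ENNReal.ofReal_add ENNReal.toReal_nonneg zero_le_one,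
    ENNReal.ofReal_toReal measure_ball_lt_top.ne]
  gcongr
  exact le_self_add

theorem kap_le_of {z : E3} {s : ℝ} (hs : 0 < s) (h : s ≤ ‖z‖) : kap z ≤ ENNReal.ofReal (s⁻¹ ^ 2) := by
  have : 0 < ‖z‖ := hs.trans_le h
  rw [kap_eq (norm_pos_iff.1 this)]
  apply ENNReal.ofReal_le_ofReal
  rw [inv_pow]
  gcongr

theorem le_kap_of {z : E3} {s : ℝ} (hs : 0 < s) (h : ‖z‖ ≤ s) : ENNReal.ofReal (s⁻¹ ^ 2) ≤ kap z := by
  by_cases hz : z = 0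
  · simp [kap, hz]
  · have : 0 < ‖z‖ := norm_pos_iff.2 hz
    rw [kap_eq hz]
    apply ENNReal.ofReal_le_ofReal
    rw [inv_pow]
    gcongr

theorem kapA : ∃ C : ℝ, 0 < C ∧ ∀ (x y : E3) (s : ℝ), 0 < s →
    ∫⁻ z in closedBall x s, kap (z - y) ≤ ENNReal.ofReal (C * s ^ 3) * kap (x - y) := by
  obtain ⟨I, hI, HI⟩ := kapI
  obtain ⟨c, hc, Hc⟩ := vol_cb
  refine ⟨4 * c + 12 * I, by positivity, fun x y s hs => ?_⟩
  rcases le_or_gt (2 * s) ‖x - y‖ with h | h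
  · have pos : 0 < ‖x - y‖ := by linarith
    calc ∫⁻ z in closedBall x s, kap (z - y)
        ≤ ∫⁻ z in closedBall x s, ENNReal.ofReal 4 * kap (x - y) := by
          refine setLIntegral_mono measurable_const fun z hz => ?_
          rw [mem_closedBall, dist_eq_norm] at hz
          have t : ‖x - y‖ ≤ ‖z - y‖ + ‖z - x‖ := by
            have := norm_sub_le (z - y) (z - x)
            simpa using this
          refine (kap_le_of (s := ‖x - y‖ / 2) (by positivity) (by linarith)).trans ?_
          rw [kap_eq (norm_pos_iff.1 pos), ← ENNReal.ofReal_mul (by norm_num)]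
          apply ENNReal.ofReal_le_ofReal (le_of_eq _)
          field_simp; norm_num
      _ = ENNReal.ofReal 4 * kap (x - y) * volume (closedBall x s) := by simp
      _ ≤ ENNReal.ofReal 4 * kap (x - y) * ENNReal.ofReal (c * s ^ 3) := by
          gcongr; exact Hc s hs x
      _ = ENNReal.ofReal (4 * c * s ^ 3) * kap (x - y) := by
          rw [mul_assoc 4 c, ENNReal.ofReal_mul (by norm_num : (0:ℝ) ≤ 4)]; ring
      _ ≤ _ := by gcongr; linarith
  · calc ∫⁻ z in closedBall x s, kap (z - y) ≤ ∫⁻ z in closedBall y (3 * s), kap (y - z) := by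
          simp only [kap_symm _ y]
          refine lintegral_mono_set (closedBall_subset_closedBall' ?_)
          rw [dist_eq_norm]; linarith
      _ ≤ ENNReal.ofReal (I * (3 * s)) := HI _ (by positivity) y
      _ = ENNReal.ofReal (12 * I * s ^ 3) * ENNReal.ofReal ((2 * s)⁻¹ ^ 2) := by
          rw [← ENNReal.ofReal_mul (by positivity)]; congr 1; field_simp; norm_num
      _ ≤ _ := by
          gcongr
          · linarith
          · exact le_kap_of (by positivity) h.le

theorem farJ : ∃ J : ℝ, 0 < J ∧ ∀ (ds p : ℝ) (x0 : E3), 0 < ds → 5 / 4 ≤ p →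
    ∫⁻ x in {x : E3 | ds ≤ ‖x - x0‖}, ENNReal.ofReal ((ds / ‖x - x0‖) ^ 3) ^ p
      ≤ ENNReal.ofReal (J * ds ^ 3) := by
  have hint : Integrable (fun x : E3 => (1 + ‖x‖) ^ (-(15 / 4 : ℝ))) :=
    integrable_one_add_norm (by rw [finrank_euclideanSpace_fin]; norm_num)
  have hlt := hint.lintegral_lt_top
  set L := ∫⁻ x : E3, ENNReal.ofReal ((1 + ‖x‖) ^ (-(15 / 4 : ℝ))) with hL
  refine ⟨2 ^ (15 / 4 : ℝ) * (L.toReal + 1), by positivity, fun ds p x0 hds hp => ?_⟩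
  have hm : MeasurableSet {x : E3 | ds ≤ ‖x - x0‖} := measurableSet_le measurable_const (by fun_prop)
  rw [← lintegral_indicator hm]
  rw [← lintegral_add_left_eq_self _ x0, lint_scale hds]
  have key : ∀ z : E3, {x : E3 | ds ≤ ‖x - x0‖}.indicator
      (fun x => ENNReal.ofReal ((ds / ‖x - x0‖) ^ 3) ^ p) (x0 + ds • z) ≤
      ENNReal.ofReal (2 ^ (15 / 4 : ℝ)) * ENNReal.ofReal ((1 + ‖z‖) ^ (-(15 / 4 : ℝ))) := by
    intro z
    by_cases hz : 1 ≤ ‖z‖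
    · have hz0 : 0 < ‖z‖ := by linarith
      rw [indicator_of_mem (by simp [norm_smul, abs_of_pos hds]; nlinarith)]
      simp only [add_sub_cancel_left, norm_smul, Real.norm_of_nonneg hds.le]
      have e : ds / (ds * ‖z‖) = ‖z‖⁻¹ := by field_simp
      rw [e, ENNReal.ofReal_rpow_of_pos (by positivity), ← ENNReal.ofReal_mul (by positivity)]
      apply ENNReal.ofReal_le_ofReal
      have i1 : ‖z‖⁻¹ ≤ 1 := inv_le_one_of_one_le₀ hz
      have i2 : ‖z‖⁻¹ ≤ 2 * (1 + ‖z‖)⁻¹ := by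
        rw [← div_eq_mul_inv, le_div_iff₀ (by positivity)]
        have : ‖z‖⁻¹ * ‖z‖ = 1 := by field_simp
        nlinarith
      calc (‖z‖⁻¹ ^ 3) ^ p = ‖z‖⁻¹ ^ (3 * p) := by
            rw [← Real.rpow_natCast, ← Real.rpow_mul (by positivity)]; norm_num
        _ ≤ ‖z‖⁻¹ ^ (15 / 4 : ℝ) :=
            Real.rpow_le_rpow_of_exponent_ge (by positivity) i1 (by linarith)
        _ ≤ (2 * (1 + ‖z‖)⁻¹) ^ (15 / 4 : ℝ) := by gcongr
        _ = _ := by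
            rw [Real.mul_rpow (by norm_num) (by positivity), Real.inv_rpow (by positivity),
              Real.rpow_neg (by positivity)]
    · rw [indicator_of_notMem]
      · exact zero_le
      · simp [norm_smul, abs_of_pos hds]; nlinarith
  calc _ ≤ ENNReal.ofReal (ds ^ 3) * ∫⁻ z : E3, ENNReal.ofReal (2 ^ (15 / 4 : ℝ)) *
          ENNReal.ofReal ((1 + ‖z‖) ^ (-(15 / 4 : ℝ))) := by gcongr with z; exact key z
    _ = ENNReal.ofReal (ds ^ 3) * (ENNReal.ofReal (2 ^ (15 / 4 : ℝ)) * L) := by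
        rw [lintegral_const_mul' _ _ ENNReal.ofReal_ne_top]
    _ ≤ ENNReal.ofReal (ds ^ 3) * (ENNReal.ofReal (2 ^ (15 / 4 : ℝ)) *
          ENNReal.ofReal (L.toReal + 1)) := by
        gcongr
        rw [ENNReal.ofReal_add ENNReal.toReal_nonneg zero_le_one, ENNReal.ofReal_toReal hlt.ne]
        exact le_self_add
    _ = _ := by
        rw [← ENNReal.ofReal_mul (by positivity), ← ENNReal.ofReal_mul (by positivity)]
        congr 1; ring

theorem lap_add {f g : E3 → ℝ} {x : E3} (hf : ContDiffAt ℝ 2 f x) (hg : ContDiffAt ℝ 2 g x) :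
    lap (fun y => f y + g y) x = lap f x + lap g x := by
  have ev : ∀ i, pd i (fun y => f y + g y) =ᶠ[nhds x] fun y => pd i f y + pd i g y := by
    intro i
    filter_upwards [hf.eventually (by norm_num), hg.eventually (by norm_num)] with y h1 h2
    exact pd_add i (h1.differentiableAt (by norm_num)) (h2.differentiableAt (by norm_num))
  rw [lap_eq, lap_eq, lap_eq, ← Finset.sum_add_distrib]
  refine Finset.sum_congr rfl fun i _ => ?_
  rw [pd_congr (ev i), pd_add i ((contDiffAt_pd hf i).differentiableAt (by norm_num))
    ((contDiffAt_pd hg i).differentiableAt (by norm_num))]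

theorem lap_const_mul (a : ℝ) (f : E3 → ℝ) (x : E3) : lap (fun y => a * f y) x = a * lap f x := by
  rw [lap_eq, lap_eq, Finset.mul_sum]
  refine Finset.sum_congr rfl fun i _ => ?_
  have : pd i (fun y => a * f y) = fun y => a * pd i f y := funext fun y => pd_const_mul a i
  rw [this, pd_const_mul]

theorem lap_neg' (f : E3 → ℝ) (x : E3) : lap (fun y => - f y) x = - lap f x := by
  have := lap_const_mul (-1) f x
  simpa using this

theorem support_plane {Ω : Set E3} (hΩo : IsOpen Ω) (hΩc : Convex ℝ Ω) (hne : Ω.Nonempty)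
    {q : E3} (hq : q ∉ Ω) : ∃ n : E3, ‖n‖ = 1 ∧ ∀ y ∈ Ω, ⟪n, y⟫ < ⟪n, q⟫ := by
  obtain ⟨f, hf⟩ := geometric_hahn_banach_open_point hΩc hΩo hq
  set m := (InnerProductSpace.toDual ℝ E3).symm f with hm
  have hm' : ∀ y, ⟪m, y⟫ = f y := fun y => InnerProductSpace.toDual_symm_apply
  have m0 : m ≠ 0 := by
    intro h
    obtain ⟨y, hy⟩ := hne
    have := hf y hy
    rw [← hm', ← hm', h] at this
    simp at this
  have mp : 0 < ‖m‖ := norm_pos_iff.2 m0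
  refine ⟨‖m‖⁻¹ • m, ?_, fun y hy => ?_⟩
  · rw [norm_smul, norm_inv, norm_norm]; field_simp
  · rw [real_inner_smul_left, real_inner_smul_left, hm', hm']
    have := hf y hy
    gcongr

theorem super_compact {U : Set E3} (hUo : IsOpen U) (hUb : Bornology.IsBounded U) {w : E3 → ℝ}
    (hw : ContinuousOn w (closure U)) (h0 : ∀ x ∈ frontier U, w x ≤ 0) (ε : ℝ) (hε : 0 < ε) :
    IsCompact {x | x ∈ U ∧ ε ≤ w x} := by
  have e : {x | x ∈ U ∧ ε ≤ w x} = closure U ∩ w ⁻¹' Ici ε := by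
    ext x
    constructor
    · rintro ⟨h1, h2⟩; exact ⟨subset_closure h1, h2⟩
    · rintro ⟨h1, h2⟩
      refine ⟨?_, h2⟩
      by_contra h
      have : x ∈ frontier U := by rw [hUo.frontier_eq]; exact ⟨h1, h⟩
      have := h0 x this
      have h3 : ε ≤ w x := h2
      linarith
  rw [e]
  exact hUb.isCompact_closure.of_isClosed_subset
    (hw.preimage_isClosed_of_isClosed isClosed_closure isClosed_Ici) inter_subset_left

def FF (Ω : Set E3) (v : E3 → ℝ) : E3 → ℝ≥0∞ := Ω.indicator (fun y => ‖lap v y‖ₑ)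

def TT (Ω : Set E3) (v : E3 → ℝ) (x : E3) : ℝ≥0∞ := ∫⁻ y, kap (x - y) * FF Ω v y

theorem measurable_FF {Ω : Set E3} (hΩo : IsOpen Ω) (v : E3 → ℝ) : Measurable (FF Ω v) :=
  (measurable_lap v).enorm.indicator hΩo.measurableSet

theorem v_bound {Ω : Set E3} (hΩo : IsOpen Ω) (hΩb : Bornology.IsBounded Ω)
    {v : E3 → ℝ} (hv : ContDiffOn ℝ 2 v (closure Ω)) (h0 : ∀ x ∈ frontier Ω, v x = 0)
    {n q : E3} (hn : ‖n‖ = 1) (hs : ∀ y ∈ Ω, ⟪n, y⟫ < ⟪n, q⟫) {z : E3} (hz : z ∈ Ω) :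
    ENNReal.ofReal c0 * ‖v z‖ₑ ≤ ∫⁻ y, ENNReal.ofReal (2 * min (⟪n, q⟫ - ⟪n, z⟫) (⟪n, q⟫ - ⟪n, y⟫))
      * kap (z - y) * FF Ω v y := by
  have h1 := compar hΩo (hv.mono subset_closure)
    (super_compact hΩo hΩb hv.continuousOn fun x hx => (h0 x hx).le) hn hs (g := FF Ω v)
    (fun y hy => by
      rw [FF, indicator_of_mem hy, Real.enorm_eq_ofReal_abs]
      exact ENNReal.ofReal_le_ofReal (neg_le_abs _)) hz
  have h2 := compar hΩo (w := fun y => - v y) (hv.neg.mono subset_closure)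
    (super_compact hΩo hΩb hv.neg.continuousOn fun x hx => by simp [h0 x hx]) hn hs (g := FF Ω v)
    (fun y hy => by
      rw [FF, indicator_of_mem hy, Real.enorm_eq_ofReal_abs, lap_neg', neg_neg]
      exact ENNReal.ofReal_le_ofReal (le_abs_self _)) hz
  have hc := c0_pos
  rw [Real.enorm_eq_ofReal_abs, ← ENNReal.ofReal_mul hc.le]
  rcases abs_cases (v z) with ⟨h, -⟩ | ⟨h, -⟩ <;> rw [h] <;> assumption

theorem div_c0 {a b : ℝ≥0∞} (h : ENNReal.ofReal c0 * a ≤ b) : a ≤ ENNReal.ofReal c0⁻¹ * b := by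
  have hc := c0_pos
  calc a = ENNReal.ofReal c0⁻¹ * (ENNReal.ofReal c0 * a) := by
        rw [← mul_assoc, ← ENNReal.ofReal_mul (by positivity), inv_mul_cancel₀ hc.ne']; simp
    _ ≤ _ := by gcongr

theorem v_near {Ω : Set E3} (hΩo : IsOpen Ω) (hΩb : Bornology.IsBounded Ω) (hΩc : Convex ℝ Ω)
    {v : E3 → ℝ} (hv : ContDiffOn ℝ 2 v (closure Ω)) (h0 : ∀ x ∈ frontier Ω, v x = 0)
    {q : E3} (hq : q ∉ Ω) {z : E3} (hz : z ∈ Ω) {t : ℝ} (ht : ‖q - z‖ ≤ t) :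
    ‖v z‖ₑ ≤ ENNReal.ofReal (2 * c0⁻¹ * t) * TT Ω v z := by
  obtain ⟨n, hn, hs⟩ := support_plane hΩo hΩc ⟨z, hz⟩ hq
  have hc := c0_pos
  have tn : 0 ≤ t := (norm_nonneg _).trans ht
  refine (div_c0 (v_bound hΩo hΩb hv h0 hn hs hz)).trans ?_
  have e : 2 * c0⁻¹ * t = c0⁻¹ * (2 * t) := by ring
  rw [e, ENNReal.ofReal_mul (by positivity), mul_assoc, TT]
  refine mul_le_mul_right ?_ _
  rw [← lintegral_const_mul' _ _ ENNReal.ofReal_ne_top]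
  refine lintegral_mono fun y => ?_
  dsimp only
  rw [mul_assoc]
  gcongr
  refine (min_le_left _ _).trans ?_
  rw [← inner_sub_right]
  refine (real_inner_le_norm _ _).trans ?_
  rw [hn, one_mul]; exact ht

theorem TT_avg : ∃ C : ℝ, 0 < C ∧ ∀ (Ω : Set E3) (v : E3 → ℝ), IsOpen Ω → ∀ (x : E3) (s : ℝ), 0 < s →
    ∫⁻ z in closedBall x s, TT Ω v z ≤ ENNReal.ofReal (C * s ^ 3) * TT Ω v x := by
  obtain ⟨C, hC, H⟩ := kapA
  refine ⟨C, hC, fun Ω v hΩo x s hs => ?_⟩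
  have hF := measurable_FF hΩo v
  unfold TT
  rw [lintegral_lintegral_swap]
  · rw [← lintegral_const_mul' _ _ ENNReal.ofReal_ne_top]
    refine lintegral_mono fun y => ?_
    dsimp only
    have mk : Measurable fun z : E3 => kap (z - y) := measurable_kap.comp (measurable_id.sub_const y)
    rw [lintegral_mul_const _ mk, ← mul_assoc]
    gcongr
    exact H x y s hs
  · apply Measurable.aemeasurable
    exact (measurable_kap.comp (by fun_prop)).mul (hF.comp measurable_snd)

theorem grad_near : ∃ C : ℝ, 0 < C ∧ ∀ (Ω : Set E3) (_ : IsOpen Ω) (_ : Bornology.IsBounded Ω)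
    (_ : Convex ℝ Ω) (v : E3 → ℝ) (_ : ContDiffOn ℝ 2 v (closure Ω)) (_ : ∀ x ∈ frontier Ω, v x = 0)
    (q : E3) (_ : q ∉ Ω) (x : E3) (_ : x ∈ Ω) (r : ℝ) (_ : 0 < r) (_ : ball x r ⊆ Ω)
    (_ : ‖q - x‖ ≤ r) (i : Fin 3), ‖pd i v x‖ₑ ≤ ENNReal.ofReal C * TT Ω v x := by
  obtain ⟨A, hA, HA⟩ := TT_avg
  obtain ⟨G, hG, HG⟩ := gradX
  have hc := c0_pos
  refine ⟨G * (1 + 6 * c0⁻¹ * A), by positivity, ?_⟩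
  intro Ω hΩo hΩb hΩc v hv h0 q hq x hx r hr hb hqx i
  have hcb : closedBall x (r / 2) ⊆ Ω := (closedBall_subset_ball (by linarith)).trans hb
  refine (HG Ω v hΩo (hv.mono subset_closure) x (r / 2) (by positivity)
    (by rw [mul_div_cancel₀ r two_ne_zero]; exact hb) i).trans ?_
  rw [ENNReal.ofReal_mul hG.le, mul_assoc]
  refine mul_le_mul_right ?_ _
  rw [ENNReal.ofReal_add zero_le_one (by positivity), add_mul]
  refine add_le_add ?_ ?_
  · rw [ENNReal.ofReal_one, one_mul, TT, ← lintegral_indicator isClosed_closedBall.measurableSet]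
    refine lintegral_mono fun y => ?_
    by_cases hy : y ∈ closedBall x (r / 2)
    · rw [indicator_of_mem hy, FF, indicator_of_mem (hcb hy)]
    · rw [indicator_of_notMem hy]; exact zero_le
  · calc ENNReal.ofReal ((r / 2)⁻¹ ^ 4) * ∫⁻ y in closedBall x (r / 2), ‖v y‖ₑ
        ≤ ENNReal.ofReal ((r / 2)⁻¹ ^ 4) * ∫⁻ y in closedBall x (r / 2),
          ENNReal.ofReal (2 * c0⁻¹ * (3 / 2 * r)) * TT Ω v y := by
          refine mul_le_mul_right ?_ _
          refine setLIntegral_mono' isClosed_closedBall.measurableSet fun z hz => ?_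
          refine v_near hΩo hΩb hΩc hv h0 hq (hcb hz) ?_
          rw [mem_closedBall, dist_eq_norm] at hz
          have := norm_sub_le (q - x) (z - x)
          rw [sub_sub_sub_cancel_right] at this
          linarith
      _ ≤ ENNReal.ofReal ((r / 2)⁻¹ ^ 4) * (ENNReal.ofReal (2 * c0⁻¹ * (3 / 2 * r)) *
          (ENNReal.ofReal (A * (r / 2) ^ 3) * TT Ω v x)) := by
          rw [lintegral_const_mul' _ _ ENNReal.ofReal_ne_top]
          gcongr
          exact HA Ω v hΩo x _ (by positivity)
      _ = _ := by
          rw [← mul_assoc, ← mul_assoc, ← ENNReal.ofReal_mul (by positivity),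
            ← ENNReal.ofReal_mul (by positivity)]
          congr 2
          field_simp; norm_num

theorem v_far {Ω : Set E3} (hΩo : IsOpen Ω) (hΩb : Bornology.IsBounded Ω) (hΩc : Convex ℝ Ω)
    {v : E3 → ℝ} (hv : ContDiffOn ℝ 2 v (closure Ω)) (h0 : ∀ x ∈ frontier Ω, v x = 0)
    {x0 q : E3} {ds : ℝ} (hds : 0 < ds) (hq : q ∉ Ω) (hqx : ‖q - x0‖ ≤ ds)
    (hl : ∀ x ∈ Ω, x ∉ closedBall x0 ds → lap v x = 0) (hfin : ∫⁻ y, FF Ω v y ≠ ⊤)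
    {R : ℝ} (hR : 8 * ds ≤ R) {z : E3} (hz : z ∈ Ω) (hzR : R / 4 ≤ ‖z - x0‖) :
    |v z| ≤ 256 * c0⁻¹ * ds * R⁻¹ ^ 2 * (∫⁻ y, FF Ω v y).toReal := by
  obtain ⟨n, hn, hs⟩ := support_plane hΩo hΩc ⟨z, hz⟩ hq
  have hc := c0_pos
  have Rp : 0 < R := by linarith
  have key := div_c0 (v_bound hΩo hΩb hv h0 hn hs hz)
  have b : ∫⁻ y, ENNReal.ofReal (2 * min (⟪n, q⟫ - ⟪n, z⟫) (⟪n, q⟫ - ⟪n, y⟫))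
      * kap (z - y) * FF Ω v y ≤ ENNReal.ofReal (2 * (2 * ds)) * ENNReal.ofReal ((R / 8)⁻¹ ^ 2) *
        ∫⁻ y, FF Ω v y := by
    rw [← lintegral_const_mul' _ _ (by finiteness)]
    refine lintegral_mono fun y => ?_
    dsimp only
    by_cases hy : y ∈ Ω
    · by_cases hy2 : y ∈ closedBall x0 ds
      · rw [mem_closedBall, dist_eq_norm] at hy2
        gcongr
        · refine (min_le_right _ _).trans ?_
          rw [← inner_sub_right]
          refine (real_inner_le_norm _ _).trans ?_
          rw [hn, one_mul]
          have := norm_sub_le (q - x0) (y - x0)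
          rw [sub_sub_sub_cancel_right] at this
          linarith
        · refine kap_le_of (by positivity) ?_
          have := norm_add_le (z - y) (y - x0)
          rw [sub_add_sub_cancel] at this
          linarith
      · rw [FF, indicator_of_mem hy, hl y hy hy2]; simp
    · rw [FF, indicator_of_notMem hy]; simp
  have k2 := key.trans (mul_le_mul_right b _)
  rw [← ENNReal.ofReal_toReal hfin, ← ENNReal.ofReal_mul (by positivity),
    ← ENNReal.ofReal_mul (by positivity), ← ENNReal.ofReal_mul (by positivity),
    Real.enorm_eq_ofReal_abs, ENNReal.ofReal_le_ofReal_iff (by positivity)] at k2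
  refine k2.trans (le_of_eq ?_)
  field_simp; norm_num; ring

theorem hd_inv1 (t : ℝ) (ht : t ∈ Ioi (0:ℝ)) : HasDerivAt (fun t : ℝ => t⁻¹) (-(t ^ 2)⁻¹) t := by
  simpa using hasDerivAt_inv (ne_of_gt ht)

theorem hd_inv2 (t : ℝ) (ht : t ∈ Ioi (0:ℝ)) :
    HasDerivAt (fun t : ℝ => -(t ^ 2)⁻¹) (2 * (t ^ 3)⁻¹) t := by
  have t0 : t ≠ 0 := ne_of_gt ht
  have h := ((hasDerivAt_pow 2 t).inv (pow_ne_zero 2 t0)).neg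
  refine h.congr_deriv ?_
  simp; field_simp

theorem lap_barrier (K k : ℝ) (o y : E3) (hy : y ≠ o) :
    lap (fun y => K * (‖y - o‖ ^ 2)⁻¹ + k) y = 2 * K * ((‖y - o‖ ^ 2) ^ 2)⁻¹ ∧
    ContDiffAt ℝ 2 (fun y => K * (‖y - o‖ ^ 2)⁻¹ + k) y := by
  have p : 0 < ‖y - o‖ ^ 2 := by
    have := norm_pos_iff.2 (sub_ne_zero.2 hy); positivity
  have cd : ContDiffAt ℝ 2 (fun y => (‖y - o‖ ^ 2)⁻¹) y :=
    ((contDiff_id.sub contDiff_const).norm_sq ℝ).contDiffAt.inv p.ne'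
  have cd2 : ContDiffAt ℝ 2 (fun y => K * (‖y - o‖ ^ 2)⁻¹) y := contDiffAt_const.mul cd
  refine ⟨?_, cd2.add contDiffAt_const⟩
  have lk : lap (fun _ => k) y = 0 := by simp [lap]
  rw [lap_add cd2 contDiffAt_const, lk, lap_const_mul,
    lap_comp_sub (fun y => (‖y‖ ^ 2)⁻¹) o y, lap_rad isOpen_Ioi hd_inv1 hd_inv2 p]
  field_simp; ring

theorem barrier {Ω : Set E3} (hΩo : IsOpen Ω) {v : E3 → ℝ} (hv : ContDiffOn ℝ 2 v (closure Ω))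
    (h0 : ∀ x ∈ frontier Ω, v x = 0) {n q o : E3} (hn : ‖n‖ = 1)
    (hs : ∀ y ∈ Ω, ⟪n, y⟫ < ⟪n, q⟫) {k M : ℝ} (hk : 0 < k) (hM : 0 ≤ M) (ho : o = q + k • n)
    (hl : ∀ y ∈ Ω ∩ ball o (2 * k), lap v y = 0)
    (hb : ∀ y ∈ Ω, ‖y - o‖ = 2 * k → v y ≤ M) {z : E3} (hz : z ∈ Ω) (hzo : ‖z - o‖ < 2 * k) :
    v z ≤ 4 / 3 * M * (1 - k ^ 2 * (‖z - o‖ ^ 2)⁻¹) := by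
  set U := Ω ∩ ball o (2 * k) with hU
  have far : ∀ y ∈ closure Ω, k ≤ ‖y - o‖ := by
    have h1 : ∀ y ∈ Ω, k ≤ ‖y - o‖ := by
      intro y hy
      have h2 : ⟪n, o - y⟫ ≤ ‖o - y‖ := by
        refine (real_inner_le_norm _ _).trans ?_
        rw [hn, one_mul]
      have h3 : ⟪n, o - y⟫ = ⟪n, q⟫ - ⟪n, y⟫ + k := by
        rw [ho, inner_sub_right, inner_add_right, real_inner_smul_right, real_inner_self_eq_norm_sq,
          hn]; ring
      have := hs y hy
      rw [norm_sub_rev]; linarith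
    intro y hy
    have : closure Ω ⊆ {y | k ≤ ‖y - o‖} :=
      closure_minimal h1 (isClosed_le continuous_const (by fun_prop))
    exact this hy
  have ne : ∀ y ∈ closure Ω, y ≠ o := by
    intro y hy h
    have := far y hy
    rw [h] at this; simp at this; linarith
  set K := 4 / 3 * M * k ^ 2 with hK
  set w : E3 → ℝ := fun y => v y + (K * (‖y - o‖ ^ 2)⁻¹ + -(4 / 3 * M)) with hw
  have oU : IsOpen U := hΩo.inter isOpen_ball
  have cw : ContDiffOn ℝ 2 w (closure Ω) := hv.add fun y hy =>
    (lap_barrier K _ o y (ne y hy)).2.contDiffWithinAt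
  have cl : closure U ⊆ closure Ω := closure_mono inter_subset_left
  have nonp : ∀ y ∈ closure Ω, K * (‖y - o‖ ^ 2)⁻¹ + -(4 / 3 * M) ≤ 0 := by
    intro y hy
    have := far y hy
    have h2 : k ^ 2 * (‖y - o‖ ^ 2)⁻¹ ≤ 1 := by
      rw [← div_eq_mul_inv]
      apply div_le_one_of_le₀ _ (by positivity)
      gcongr
    rw [hK, mul_assoc]
    nlinarith
  have bd : ∀ y ∈ frontier U, w y ≤ 0 := by
    intro y hy
    have hyc : y ∈ closure Ω := cl (frontier_subset_closure hy)
    by_cases hyf : y ∈ frontier Ω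
    · have := nonp y hyc
      simp only [hw, h0 y hyf]; linarith
    · have yΩ : y ∈ Ω := by
        by_contra h
        exact hyf (by rw [hΩo.frontier_eq]; exact ⟨hyc, h⟩)
      have h3 : ‖y - o‖ = 2 * k := by
        rcases frontier_inter_subset _ _ hy with h | h
        · exact absurd h.1 hyf
        · have := frontier_ball_subset_sphere h.2
          rwa [mem_sphere, dist_eq_norm] at this
      have h4 := hb y yΩ h3
      simp only [hw, h3, hK]
      have : 4 / 3 * M * k ^ 2 * ((2 * k) ^ 2)⁻¹ = M / 3 := by field_simp; norm_num; ring
      linarith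
  have zU : z ∈ U := ⟨hz, by rwa [mem_ball, dist_eq_norm]⟩
  have := compar oU (cw.mono (subset_closure.trans cl))
    (super_compact oU (isBounded_ball.subset inter_subset_right) (cw.continuousOn.mono cl) bd)
    hn (a := ⟪n, q⟫) (fun y hy => hs y hy.1) (g := fun _ => 0) (fun y hy => by
      have hb := lap_barrier K (-(4 / 3 * M)) o y (ne y (subset_closure hy.1))
      rw [lap_add ((hv.mono subset_closure).contDiffAt (hΩo.mem_nhds hy.1)) hb.2, hb.1, hl y hy]
      simp only [nonpos_iff_eq_zero, ENNReal.ofReal_eq_zero]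
      have : 0 ≤ 2 * K * ((‖y - o‖ ^ 2) ^ 2)⁻¹ := by positivity
      linarith) zU
  simp only [mul_zero, lintegral_zero, nonpos_iff_eq_zero, ENNReal.ofReal_eq_zero] at this
  have hc := c0_pos
  have hwz : w z ≤ 0 := by
    by_contra h
    have := mul_pos hc (not_le.1 h)
    linarith
  simp only [hw, hK] at hwz
  linarith

theorem v_far2 {Ω : Set E3} (hΩo : IsOpen Ω) (hΩc : Convex ℝ Ω)
    {v : E3 → ℝ} (hv : ContDiffOn ℝ 2 v (closure Ω)) (h0 : ∀ x ∈ frontier Ω, v x = 0)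
    {x0 q q0 x : E3} {ds r R M : ℝ} (hds : 0 < ds) (hq : q ∉ Ω) (hq0 : q0 ∉ Ω)
    (hqx : ‖q0 - x0‖ ≤ ds)
    (hl : ∀ x ∈ Ω, x ∉ closedBall x0 ds → lap v x = 0)
    (hR : 8 * ds ≤ R) (hxR : ‖x - x0‖ = R) (hx : x ∈ Ω) (hr : 0 < r) (hb : ball x r ⊆ Ω)
    (hqr : ‖q - x‖ ≤ r) (hM0 : 0 ≤ M) (hM : ∀ z ∈ Ω, R / 4 ≤ ‖z - x0‖ → v z ≤ M)
    {z : E3} (hz : z ∈ closedBall x (r / 2)) :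
    v z ≤ 32 * M * r * R⁻¹ ∧ ds < ‖z - x0‖ := by
  have Rp : 0 < R := by linarith
  have zΩ : z ∈ Ω := hb (closedBall_subset_ball (by linarith) hz)
  rw [mem_closedBall, dist_eq_norm] at hz
  have r1 : r ≤ R + ds := by
    by_contra h
    push Not at h
    apply hq0
    apply hb
    rw [mem_ball, dist_eq_norm]
    have := norm_sub_le (q0 - x0) (x - x0)
    rw [sub_sub_sub_cancel_right] at this
    linarith
  have tri : ∀ y : E3, R - ‖y - x‖ ≤ ‖y - x0‖ := by
    intro y
    have := norm_sub_le (y - x0) (y - x)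
    rw [sub_sub_sub_cancel_left] at this
    linarith
  have tz := tri z
  refine ⟨?_, by linarith⟩
  rcases le_or_gt (R / 12) r with h | h
  · refine (hM z zΩ (by linarith)).trans ?_
    rw [← div_eq_mul_inv, le_div_iff₀ Rp]
    nlinarith
  · obtain ⟨n, hn, hs⟩ := support_plane hΩo hΩc ⟨x, hx⟩ hq
    set k := R / 8 with hk
    set o := q + k • n with ho
    have kp : 0 < k := by positivity
    have qo : ‖q - o‖ = k := by
      rw [ho, norm_sub_rev, add_sub_cancel_left, norm_smul, hn, mul_one, Real.norm_of_nonneg kp.le]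
    have xo : ‖x - o‖ ≤ r + k := by
      have := norm_add_le (x - q) (q - o)
      rw [sub_add_sub_cancel, norm_sub_rev x q] at this
      linarith
    have zo : ‖z - o‖ ≤ k + 3 / 2 * r := by
      have := norm_add_le (z - x) (x - o)
      rw [sub_add_sub_cancel] at this
      linarith
    have dd : ∀ y : E3, ‖y - o‖ ≤ 2 * k → R / 4 ≤ ‖y - x0‖ := by
      intro y hy
      have := norm_sub_le (y - o) (x - o)
      rw [sub_sub_sub_cancel_right] at this
      have := tri y
      linarith
    have B := barrier hΩo hv h0 hn hs kp hM0 ho (fun y hy => by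
      refine hl y hy.1 fun h => ?_
      rw [mem_closedBall, dist_eq_norm] at h
      have h2 := hy.2
      rw [mem_ball, dist_eq_norm] at h2
      have := dd y h2.le
      linarith) (fun y hy h => hM y hy (dd y h.le)) zΩ (by linarith)
    refine B.trans ?_
    have zpos : 0 < ‖z - o‖ := by
      have h2 : ⟪n, o - z⟫ ≤ ‖o - z‖ := by
        refine (real_inner_le_norm _ _).trans ?_
        rw [hn, one_mul]
      have h3 : ⟪n, o - z⟫ = ⟪n, q⟫ - ⟪n, z⟫ + k := by
        rw [ho, inner_sub_right, inner_add_right, real_inner_smul_right, real_inner_self_eq_norm_sq,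
          hn]; ring
      have := hs z zΩ
      rw [norm_sub_rev]; linarith
    have h5 : k ^ 2 * (‖z - o‖ ^ 2)⁻¹ ≥ 1 - 3 * r / k := by
      have h6 : ((k + 3 / 2 * r) ^ 2)⁻¹ ≤ (‖z - o‖ ^ 2)⁻¹ := by gcongr
      have h7 : k ^ 2 * ((k + 3 / 2 * r) ^ 2)⁻¹ ≥ 1 - 3 * r / k := by
        rw [← div_eq_mul_inv, ge_iff_le, le_div_iff₀ (by positivity)]
        have : 3 * r / k * k = 3 * r := by field_simp
        have u : 0 ≤ 3 * r / k := by positivity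
        nlinarith [mul_nonneg u hr.le, mul_nonneg u (sq_nonneg r), sq_nonneg r]
      nlinarith [sq_nonneg k]
    have h8 : 3 * r / k = 24 * r * R⁻¹ := by rw [hk]; field_simp; norm_num
    rw [h8] at h5
    nlinarith

theorem far_all : ∃ C : ℝ, 0 < C ∧ ∀ (Ω : Set E3) (_ : IsOpen Ω) (_ : Bornology.IsBounded Ω)
    (_ : Convex ℝ Ω) (v : E3 → ℝ) (_ : ContDiffOn ℝ 2 v (closure Ω)) (_ : ∀ x ∈ frontier Ω, v x = 0)
    (x0 q q0 x : E3) (ds r R : ℝ) (_ : 0 < ds) (_ : q ∉ Ω) (_ : q0 ∉ Ω)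
    (_ : ‖q0 - x0‖ ≤ ds) (_ : ∀ x ∈ Ω, x ∉ closedBall x0 ds → lap v x = 0)
    (_ : 8 * ds ≤ R) (_ : ‖x - x0‖ = R) (_ : x ∈ Ω) (_ : 0 < r) (_ : ball x r ⊆ Ω)
    (_ : ‖q - x‖ ≤ r) (_ : ∫⁻ y, FF Ω v y ≠ ⊤),
    ‖v x‖ₑ ≤ ENNReal.ofReal (C * r * ds * R⁻¹ ^ 3) * ∫⁻ y, FF Ω v y ∧
    ∀ i : Fin 3, ‖pd i v x‖ₑ ≤ ENNReal.ofReal (C * ds * R⁻¹ ^ 3) * ∫⁻ y, FF Ω v y := by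
  obtain ⟨G, hG, HG⟩ := gradX
  obtain ⟨c, hc, Hc⟩ := vol_cb
  have hc0 := c0_pos
  refine ⟨32 * (256 * c0⁻¹) * (1 + 2 * G * c), by positivity, ?_⟩
  intro Ω hΩo hΩb hΩc v hv h0 x0 q q0 x ds r R hds hq hq0 hqx hl hR hxR hx hr hb hqr hfin
  have Rp : 0 < R := by linarith
  set F1 := (∫⁻ y, FF Ω v y).toReal with hF1
  set M := 256 * c0⁻¹ * ds * R⁻¹ ^ 2 * F1 with hM
  have M0 : 0 ≤ M := by positivity
  have F1' : ∫⁻ y, FF Ω v y = ENNReal.ofReal F1 := (ENNReal.ofReal_toReal hfin).symm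
  have A := fun z (hz : z ∈ Ω) (hz2 : R / 4 ≤ ‖z - x0‖) =>
    abs_le.1 (v_far hΩo hΩb hΩc hv h0 hds hq0 hqx hl hfin hR hz hz2)
  have P : ∀ z ∈ closedBall x (r / 2), |v z| ≤ 32 * M * r * R⁻¹ ∧ ds < ‖z - x0‖ := by
    intro z hz
    have h1 := v_far2 hΩo hΩc hv h0 hds hq hq0 hqx hl hR hxR hx hr hb hqr M0
      (fun z h1 h2 => (A z h1 h2).2) hz
    have h2 := v_far2 (v := fun y => - v y) hΩo hΩc hv.neg (fun y hy => by simp [h0 y hy])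
      hds hq hq0 hqx (fun y h1 h2 => by rw [lap_neg', hl y h1 h2, neg_zero]) hR hxR hx hr hb hqr M0
      (fun z h1 h2 => by have := (A z h1 h2).1; linarith) hz
    exact ⟨abs_le.2 ⟨by linarith [h2.1], h1.1⟩, h1.2⟩
  have hcb : closedBall x (r / 2) ⊆ Ω := (closedBall_subset_ball (by linarith)).trans hb
  constructor
  · rw [F1', ← ENNReal.ofReal_mul (by positivity), Real.enorm_eq_ofReal_abs]
    apply ENNReal.ofReal_le_ofReal
    refine (P x (mem_closedBall_self (by positivity))).1.trans ?_
    have e : 32 * M * r * R⁻¹ = 32 * (256 * c0⁻¹) * 1 * r * ds * R⁻¹ ^ 3 * F1 := by rw [hM]; ring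
    rw [e]
    gcongr
    have : 0 ≤ 2 * G * c := by positivity
    linarith
  · intro i
    refine (HG Ω v hΩo (hv.mono subset_closure) x (r / 2) (by positivity)
      (by rw [mul_div_cancel₀ r two_ne_zero]; exact hb) i).trans ?_
    have z1 : ∫⁻ y in closedBall x (r / 2), kap (x - y) * ‖lap v y‖ₑ = 0 := by
      rw [setLIntegral_congr_fun (g := fun _ => 0) isClosed_closedBall.measurableSet]
      · simp
      · intro y hy
        have : lap v y = 0 := hl y (hcb hy) (by
          rw [mem_closedBall, dist_eq_norm, not_le]; exact (P y hy).2)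
        simp [this]
    have z2 : ∫⁻ y in closedBall x (r / 2), ‖v y‖ₑ ≤
        ENNReal.ofReal (32 * M * r * R⁻¹) * ENNReal.ofReal (c * (r / 2) ^ 3) := by
      calc _ ≤ ∫⁻ y in closedBall x (r / 2), ENNReal.ofReal (32 * M * r * R⁻¹) := by
            refine setLIntegral_mono' isClosed_closedBall.measurableSet fun y hy => ?_
            rw [Real.enorm_eq_ofReal_abs]
            exact ENNReal.ofReal_le_ofReal (P y hy).1
        _ = ENNReal.ofReal (32 * M * r * R⁻¹) * volume (closedBall x (r / 2)) := by simp
        _ ≤ _ := by gcongr; exact Hc _ (by positivity) x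
    rw [z1, zero_add]
    refine (mul_le_mul_right (mul_le_mul_right z2 _) _).trans ?_
    rw [F1', ← ENNReal.ofReal_mul (by positivity), ← ENNReal.ofReal_mul (by positivity),
      ← ENNReal.ofReal_mul (by positivity), ← ENNReal.ofReal_mul (by positivity)]
    apply ENNReal.ofReal_le_ofReal
    have e : G * ((r / 2)⁻¹ ^ 4 * (32 * M * r * R⁻¹ * (c * (r / 2) ^ 3))) =
        32 * (256 * c0⁻¹) * (2 * G * c) * ds * R⁻¹ ^ 3 * F1 := by
      rw [hM]; field_simp
    rw [e]
    gcongr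
    linarith

def SS (v : E3 → ℝ) (x : E3) : ℝ≥0∞ := ‖v x‖ₑ + ∑ i : Fin 3, ‖pd i v x‖ₑ

theorem grad_le (v : E3 → ℝ) (x : E3) : ‖gradient v x‖ₑ ≤ ∑ i : Fin 3, ‖pd i v x‖ₑ := by
  have h : ∀ i, (gradient v x) i = pd i v x := by
    intro i
    have : ⟪gradient v x, EuclideanSpace.single i (1:ℝ)⟫ = pd i v x := by
      unfold gradient pd
      exact InnerProductSpace.toDual_symm_apply
    rw [← this, EuclideanSpace.inner_single_right]; simp
  have e : gradient v x = ∑ i : Fin 3, pd i v x • EuclideanSpace.single i (1:ℝ) := by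
    ext j
    rw [h j]
    simp [Finset.sum_apply, Pi.single_apply]
  rw [e]
  refine (enorm_sum_le _ _).trans (Finset.sum_le_sum fun i _ => ?_)
  rw [enorm_smul]
  simp [← ofReal_norm]

theorem ptwise {Ω : Set E3} (hΩo : IsOpen Ω) (hΩb : Bornology.IsBounded Ω) (hΩc : Convex ℝ Ω)
    (hne : Ω.Nonempty) : ∃ C : ℝ, 0 < C ∧ ∀ (x0 : E3) (ds : ℝ), 0 < ds →
      infDist x0 (frontier Ω) ≤ ds → ∀ v : E3 → ℝ, ContDiffOn ℝ 2 v (closure Ω) →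
      (∀ x ∈ frontier Ω, v x = 0) → (∀ x ∈ Ω, x ∉ closedBall x0 ds → lap v x = 0) →
      ∫⁻ y, FF Ω v y ≠ ⊤ → ∀ x ∈ Ω, SS v x ≤ ENNReal.ofReal C * TT Ω v x ∧
        (8 * ds ≤ ‖x - x0‖ → SS v x ≤ ENNReal.ofReal (C * ds * ‖x - x0‖⁻¹ ^ 3) * ∫⁻ y, FF Ω v y) := by
  obtain ⟨C1, hC1, H1⟩ := grad_near
  obtain ⟨C2, hC2, H2⟩ := far_all
  have hc := c0_pos
  have hun : Ω ≠ univ := by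
    intro h
    rw [h] at hΩb
    exact NormedSpace.unbounded_univ ℝ E3 hΩb
  have hcn : (Ωᶜ).Nonempty := nonempty_compl.2 hun
  have hfn : (frontier Ω).Nonempty := nonempty_frontier_iff.2 ⟨hne, hun⟩
  obtain ⟨q1, hq1⟩ := hcn
  obtain ⟨B, hB⟩ := hΩb.subset_closedBall q1
  have Bn : 0 ≤ B := by
    obtain ⟨y, hy⟩ := hne
    exact dist_nonneg.trans (mem_closedBall.1 (hB hy))
  refine ⟨2 * c0⁻¹ * B + 3 * C1 + (C2 * B + 3 * C2), by positivity, ?_⟩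
  intro x0 ds hds hinf v hv h0 hl hfin x hx
  obtain ⟨q0, hq0, e0⟩ := isClosed_frontier.exists_infDist_eq_dist hfn x0
  have hq0Ω : q0 ∉ Ω := by
    rw [hΩo.frontier_eq] at hq0; exact hq0.2
  have hq0d : ‖q0 - x0‖ ≤ ds := by
    rw [norm_sub_rev, ← dist_eq_norm, ← e0]; exact hinf
  obtain ⟨q, hq, eq⟩ := hΩo.isClosed_compl.exists_infDist_eq_dist ⟨q1, hq1⟩ x
  set r := infDist x Ωᶜ with hr
  have hqx : ‖q - x‖ ≤ r := by
    rw [norm_sub_rev, ← dist_eq_norm, ← eq]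
  have hbr : ball x r ⊆ Ω := ball_infDist_compl_subset
  have rp : 0 < r := (hΩo.isClosed_compl.notMem_iff_infDist_pos ⟨q1, hq1⟩).1 (by simpa using hx)
  have rB : r ≤ B := (infDist_le_dist_of_mem hq1).trans (mem_closedBall.1 (hB hx))
  constructor
  · have a1 := v_near hΩo hΩb hΩc hv h0 hq hx (hqx.trans rB)
    have a2 := H1 Ω hΩo hΩb hΩc v hv h0 q hq x hx r rp hbr hqx
    calc SS v x ≤ ENNReal.ofReal (2 * c0⁻¹ * B) * TT Ω v x +
          ∑ i : Fin 3, ENNReal.ofReal C1 * TT Ω v x :=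
          add_le_add a1 (Finset.sum_le_sum fun i _ => a2 i)
      _ = ENNReal.ofReal (2 * c0⁻¹ * B + 3 * C1) * TT Ω v x := by
          rw [ENNReal.ofReal_add (by positivity) (by positivity),
            ENNReal.ofReal_mul (by norm_num : (0:ℝ) ≤ 3)]
          simp; ring
      _ ≤ _ := by
          refine mul_le_mul_left (ENNReal.ofReal_le_ofReal ?_) _
          have : 0 ≤ C2 * B + 3 * C2 := by positivity
          linarith
  · intro hR
    have Rp : 0 < ‖x - x0‖ := by linarith
    obtain ⟨b1, b2⟩ := H2 Ω hΩo hΩb hΩc v hv h0 x0 q q0 x ds r _ hds hq hq0Ω hq0d hl hR rfl hx rp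
      hbr hqx hfin
    set F1 := ∫⁻ y, FF Ω v y
    calc SS v x ≤ ENNReal.ofReal (C2 * r * ds * ‖x - x0‖⁻¹ ^ 3) * F1 +
          ∑ i : Fin 3, ENNReal.ofReal (C2 * ds * ‖x - x0‖⁻¹ ^ 3) * F1 :=
          add_le_add b1 (Finset.sum_le_sum fun i _ => b2 i)
      _ = ENNReal.ofReal ((C2 * r + 3 * C2) * ds * ‖x - x0‖⁻¹ ^ 3) * F1 := by
          have : (C2 * r + 3 * C2) * ds * ‖x - x0‖⁻¹ ^ 3 = C2 * r * ds * ‖x - x0‖⁻¹ ^ 3 +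
            3 * (C2 * ds * ‖x - x0‖⁻¹ ^ 3) := by ring
          rw [this, ENNReal.ofReal_add (by positivity) (by positivity),
            ENNReal.ofReal_mul (by norm_num : (0:ℝ) ≤ 3)]
          simp; ring
      _ ≤ _ := by
          refine mul_le_mul_left (ENNReal.ofReal_le_ofReal ?_) _
          refine mul_le_mul_of_nonneg_right (mul_le_mul_of_nonneg_right ?_ hds.le) (by positivity)
          have h1 : 0 ≤ 2 * c0⁻¹ * B + 3 * C1 := by positivity
          have : C2 * r ≤ C2 * B := by gcongr
          linarith

theorem holder_w {k F : E3 → ℝ≥0∞} (hk : Measurable k) (hF : Measurable F) {p : ℝ} (hp : 1 < p) :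
    (∫⁻ y, k y * F y) ^ p ≤ (∫⁻ y, k y) ^ (p - 1) * ∫⁻ y, k y * F y ^ p := by
  have p0 : 0 < p := by linarith
  have pq := (Real.HolderConjugate.conjExponent hp).symm
  set q := p.conjExponent with hq
  have q0 : 0 < q := pq.pos
  have hqp : 1 / q + 1 / p = 1 := by
    have := pq.inv_add_inv_eq_one; simpa using this
  have h := ENNReal.lintegral_mul_le_Lp_mul_Lq volume pq (f := fun y => k y ^ (1 / q))
    (g := fun y => k y ^ (1 / p) * F y) (hk.pow_const _).aemeasurable
    ((hk.pow_const _).mul hF).aemeasurable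
  have e1 : ∀ y, ((fun y => k y ^ (1 / q)) * fun y => k y ^ (1 / p) * F y) y = k y * F y := by
    intro y
    simp only [Pi.mul_apply]
    rw [← mul_assoc, ← ENNReal.rpow_add_of_nonneg _ _ (by positivity) (by positivity), hqp,
      ENNReal.rpow_one]
  have e2 : ∀ y, (k y ^ (1 / q)) ^ q = k y := by
    intro y
    rw [← ENNReal.rpow_mul, one_div_mul_cancel q0.ne', ENNReal.rpow_one]
  have e3 : ∀ y, (k y ^ (1 / p) * F y) ^ p = k y * F y ^ p := by
    intro y
    rw [ENNReal.mul_rpow_of_nonneg _ _ p0.le, ← ENNReal.rpow_mul, one_div_mul_cancel p0.ne',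
      ENNReal.rpow_one]
  simp only [e1, e2, e3] at h
  calc (∫⁻ y, k y * F y) ^ p ≤ ((∫⁻ y, k y) ^ (1 / q) * (∫⁻ y, k y * F y ^ p) ^ (1 / p)) ^ p := by
        gcongr
    _ = _ := by
        rw [ENNReal.mul_rpow_of_nonneg _ _ p0.le, ← ENNReal.rpow_mul, ← ENNReal.rpow_mul,
          one_div_mul_cancel p0.ne', ENNReal.rpow_one]
        congr 2
        have : 1 / q = 1 - 1 / p := by linarith
        rw [this]; field_simp

theorem near_int : ∃ I : ℝ, 0 < I ∧ ∀ (Ω : Set E3) (v : E3 → ℝ), IsOpen Ω → ∀ (x0 : E3) (ds p : ℝ),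
    0 < ds → 1 < p → (∀ x ∈ Ω, x ∉ closedBall x0 ds → lap v x = 0) →
    ∫⁻ x in {x | ‖x - x0‖ < 8 * ds}, TT Ω v x ^ p ≤
      ENNReal.ofReal (I * ds) ^ p * ∫⁻ y, FF Ω v y ^ p := by
  obtain ⟨I, hI, H⟩ := kapI
  refine ⟨9 * I, by positivity, fun Ω v hΩo x0 ds p hds hp hl => ?_⟩
  have hF := measurable_FF hΩo v
  set k : E3 → ℝ≥0∞ := (closedBall (0:E3) (9 * ds)).indicator kap with hk
  have mk : Measurable k := measurable_kap.indicator isClosed_closedBall.measurableSet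
  have kint : ∀ x : E3, ∫⁻ y, k (x - y) ≤ ENNReal.ofReal (9 * I * ds) := by
    intro x
    have := H (9 * ds) (by positivity) x
    rw [← lintegral_indicator isClosed_closedBall.measurableSet] at this
    have e : 9 * I * ds = I * (9 * ds) := by ring
    rw [e]
    refine le_trans (le_of_eq ?_) this
    congr 1
    ext y
    simp [hk, indicator, dist_eq_norm, norm_sub_rev y x]
  have ksym : ∀ x y : E3, k (x - y) = k (y - x) := by
    intro x y
    simp [hk, indicator, norm_sub_rev y x, kap_symm y x]
  have Tle : ∀ x, ‖x - x0‖ < 8 * ds → TT Ω v x ^ p ≤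
      ENNReal.ofReal (9 * I * ds) ^ (p - 1) * ∫⁻ y, k (x - y) * FF Ω v y ^ p := by
    intro x hx
    have e : TT Ω v x = ∫⁻ y, k (x - y) * FF Ω v y := by
      unfold TT
      congr 1
      ext y
      by_cases hy : y ∈ Ω ∧ y ∈ closedBall x0 ds
      · have h2 := hy.2
        rw [mem_closedBall, dist_eq_norm] at h2
        rw [hk, indicator_of_mem]
        rw [mem_closedBall, dist_zero_right]
        have := norm_sub_le (x - x0) (y - x0)
        rw [sub_sub_sub_cancel_right] at this
        linarith
      · have : FF Ω v y = 0 := by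
          by_cases h : y ∈ Ω
          · rw [FF, indicator_of_mem h, hl y h fun h' => hy ⟨h, h'⟩]; simp
          · rw [FF, indicator_of_notMem h]
        simp [this]
    rw [e]
    refine (holder_w (k := fun y => k (x - y)) (mk.comp (measurable_const.sub measurable_id)) hF
      hp).trans ?_
    gcongr
    exact kint x
  have hm : MeasurableSet {x : E3 | ‖x - x0‖ < 8 * ds} :=
    measurableSet_lt (by fun_prop) measurable_const
  calc ∫⁻ x in {x | ‖x - x0‖ < 8 * ds}, TT Ω v x ^ p
      ≤ ∫⁻ x in {x | ‖x - x0‖ < 8 * ds},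
        ENNReal.ofReal (9 * I * ds) ^ (p - 1) * ∫⁻ y, k (x - y) * FF Ω v y ^ p :=
        setLIntegral_mono' hm Tle
    _ ≤ ∫⁻ x, ENNReal.ofReal (9 * I * ds) ^ (p - 1) * ∫⁻ y, k (x - y) * FF Ω v y ^ p :=
        setLIntegral_le_lintegral _ _
    _ = ENNReal.ofReal (9 * I * ds) ^ (p - 1) * ∫⁻ x, ∫⁻ y, k (x - y) * FF Ω v y ^ p := by
        rw [lintegral_const_mul' _ _ (by
          exact (ENNReal.rpow_lt_top_of_nonneg (by linarith) ENNReal.ofReal_ne_top).ne)]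
    _ = ENNReal.ofReal (9 * I * ds) ^ (p - 1) * ∫⁻ y, ∫⁻ x, k (x - y) * FF Ω v y ^ p := by
        rw [lintegral_lintegral_swap]
        exact ((mk.comp (by fun_prop)).mul ((hF.pow_const p).comp measurable_snd)).aemeasurable
    _ ≤ ENNReal.ofReal (9 * I * ds) ^ (p - 1) *
          ∫⁻ y, ENNReal.ofReal (9 * I * ds) * FF Ω v y ^ p := by
        refine mul_le_mul_right (lintegral_mono fun y => ?_) _
        dsimp only
        have mk' : Measurable fun x : E3 => k (x - y) := mk.comp (measurable_id.sub_const y)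
        rw [lintegral_mul_const _ mk']
        gcongr
        simp only [ksym _ y]
        exact kint y
    _ = _ := by
        rw [lintegral_const_mul' _ _ ENNReal.ofReal_ne_top, ← mul_assoc]
        congr 1
        nth_rewrite 2 [← ENNReal.rpow_one (ENNReal.ofReal (9 * I * ds))]
        rw [← ENNReal.rpow_add_of_nonneg _ _ (by linarith) zero_le_one]
        congr 1; ring

theorem F1_pow : ∃ c : ℝ, 1 ≤ c ∧ ∀ (Ω : Set E3) (v : E3 → ℝ), IsOpen Ω → ∀ (x0 : E3) (ds p : ℝ),
    0 < ds → 1 < p → (∀ x ∈ Ω, x ∉ closedBall x0 ds → lap v x = 0) →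
    (∫⁻ y, FF Ω v y) ^ p ≤ ENNReal.ofReal (c * ds ^ 3) ^ (p - 1) * ∫⁻ y, FF Ω v y ^ p := by
  obtain ⟨c, hc, H⟩ := vol_cb
  refine ⟨c + 1, by linarith, fun Ω v hΩo x0 ds p hds hp hl => ?_⟩
  have hF := measurable_FF hΩo v
  have e : ∀ y, FF Ω v y = (closedBall x0 ds).indicator (fun _ => 1) y * FF Ω v y := by
    intro y
    by_cases hy : y ∈ closedBall x0 ds
    · simp [hy]
    · have : FF Ω v y = 0 := by
        by_cases h : y ∈ Ω
        · rw [FF, indicator_of_mem h, hl y h hy]; simp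
        · rw [FF, indicator_of_notMem h]
      simp [this]
  rw [lintegral_congr e]
  refine (holder_w (measurable_const.indicator isClosed_closedBall.measurableSet) hF hp).trans ?_
  refine mul_le_mul' ?_ (lintegral_mono fun y => ?_)
  · gcongr
    · rw [lintegral_indicator isClosed_closedBall.measurableSet]
      simp only [lintegral_const, one_mul, MeasurableSet.univ, Measure.restrict_apply, univ_inter]
      refine (H ds hds x0).trans ?_
      gcongr; linarith
  · by_cases hy : y ∈ closedBall x0 ds <;> simp [hy]

theorem main_est {Ω : Set E3} (hΩo : IsOpen Ω) (hΩb : Bornology.IsBounded Ω) (hΩc : Convex ℝ Ω)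
    (hne : Ω.Nonempty) : ∃ C : ℝ, 0 < C ∧ ∀ (x0 : E3) (ds p : ℝ), 0 < ds → 5 / 4 ≤ p →
      infDist x0 (frontier Ω) ≤ ds → ∀ v : E3 → ℝ, ContDiffOn ℝ 2 v (closure Ω) →
      (∀ x ∈ frontier Ω, v x = 0) → (∀ x ∈ Ω, x ∉ closedBall x0 ds → lap v x = 0) →
      ∫⁻ y, FF Ω v y ≠ ⊤ →
      ∫⁻ x in Ω, SS v x ^ p ≤ ENNReal.ofReal (C * ds) ^ p * ∫⁻ y, FF Ω v y ^ p := by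
  obtain ⟨C, hC, H⟩ := ptwise hΩo hΩb hΩc hne
  obtain ⟨I, hI, HI⟩ := near_int
  obtain ⟨c, hc, Hc⟩ := F1_pow
  obtain ⟨J', hJ', HJ⟩ := farJ
  set J := J' + 1 with hJ
  refine ⟨C * I + C * J * c, by positivity, fun x0 ds p hds hp hinf v hv h0 hl hfin => ?_⟩
  have p0 : 0 < p := by linarith
  have p1 : 1 < p := by linarith
  have P := H x0 ds hds hinf v hv h0 hl hfin
  set N := ∫⁻ y, FF Ω v y ^ p with hN
  set F1 := ∫⁻ y, FF Ω v y with hF1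
  have hm : MeasurableSet {x : E3 | ‖x - x0‖ < 8 * ds} :=
    measurableSet_lt (by fun_prop) measurable_const
  have near : ∫⁻ x in Ω ∩ {x | ‖x - x0‖ < 8 * ds}, SS v x ^ p ≤ ENNReal.ofReal (C * I * ds) ^ p * N := by
    calc _ ≤ ∫⁻ x in Ω ∩ {x | ‖x - x0‖ < 8 * ds}, ENNReal.ofReal C ^ p * TT Ω v x ^ p := by
          refine setLIntegral_mono' (hΩo.measurableSet.inter hm) fun x hx => ?_
          rw [← ENNReal.mul_rpow_of_nonneg _ _ p0.le]
          gcongr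
          exact (P x hx.1).1
      _ ≤ ∫⁻ x in {x | ‖x - x0‖ < 8 * ds}, ENNReal.ofReal C ^ p * TT Ω v x ^ p :=
          lintegral_mono_set inter_subset_right
      _ = ENNReal.ofReal C ^ p * ∫⁻ x in {x | ‖x - x0‖ < 8 * ds}, TT Ω v x ^ p := by
          rw [lintegral_const_mul' _ _ (by
            exact (ENNReal.rpow_lt_top_of_nonneg p0.le ENNReal.ofReal_ne_top).ne)]
      _ ≤ ENNReal.ofReal C ^ p * (ENNReal.ofReal (I * ds) ^ p * N) := by
          gcongr; exact HI Ω v hΩo x0 ds p hds p1 hl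
      _ = _ := by
          rw [← mul_assoc, ← ENNReal.mul_rpow_of_nonneg _ _ p0.le, ← ENNReal.ofReal_mul hC.le,
            mul_assoc C]
  have far : ∫⁻ x in Ω \ {x | ‖x - x0‖ < 8 * ds}, SS v x ^ p ≤
      ENNReal.ofReal (C * J * c * ds) ^ p * N := by
    have F1t : F1 ^ p ≠ ⊤ := (ENNReal.rpow_lt_top_of_nonneg p0.le hfin).ne
    calc _ ≤ ∫⁻ x in Ω \ {x | ‖x - x0‖ < 8 * ds}, ENNReal.ofReal (C * ds⁻¹ ^ 2) ^ p * F1 ^ p *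
            ENNReal.ofReal ((ds / ‖x - x0‖) ^ 3) ^ p := by
          refine setLIntegral_mono' (hΩo.measurableSet.diff hm) fun x hx => ?_
          rw [← ENNReal.mul_rpow_of_nonneg _ _ p0.le, ← ENNReal.mul_rpow_of_nonneg _ _ p0.le]
          gcongr
          have hR : 8 * ds ≤ ‖x - x0‖ := not_lt.1 hx.2
          have Rp : 0 < ‖x - x0‖ := by linarith
          refine ((P x hx.1).2 hR).trans (le_of_eq ?_)
          rw [mul_right_comm (ENNReal.ofReal (C * ds⁻¹ ^ 2)) F1, ← ENNReal.ofReal_mul (by positivity)]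
          congr 2
          field_simp
      _ ≤ ∫⁻ x in {x | ds ≤ ‖x - x0‖}, ENNReal.ofReal (C * ds⁻¹ ^ 2) ^ p * F1 ^ p *
            ENNReal.ofReal ((ds / ‖x - x0‖) ^ 3) ^ p := by
          refine lintegral_mono_set fun x hx => ?_
          have hR : 8 * ds ≤ ‖x - x0‖ := not_lt.1 hx.2
          show ds ≤ ‖x - x0‖
          linarith
      _ = ENNReal.ofReal (C * ds⁻¹ ^ 2) ^ p * F1 ^ p * ∫⁻ x in {x | ds ≤ ‖x - x0‖},
            ENNReal.ofReal ((ds / ‖x - x0‖) ^ 3) ^ p := by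
          rw [lintegral_const_mul' _ _ (ENNReal.mul_ne_top
            (ENNReal.rpow_lt_top_of_nonneg p0.le ENNReal.ofReal_ne_top).ne F1t)]
      _ ≤ ENNReal.ofReal (C * ds⁻¹ ^ 2) ^ p * (ENNReal.ofReal (c * ds ^ 3) ^ (p - 1) * N) *
            (ENNReal.ofReal J ^ p * ENNReal.ofReal (c * ds ^ 3)) := by
          refine mul_le_mul' (mul_le_mul_right (Hc Ω v hΩo x0 ds p hds p1 hl) _) ?_
          refine (HJ ds p x0 hds hp).trans ?_
          have j1 : J ≤ J ^ p := by
            have := Real.rpow_le_rpow_of_exponent_le (x := J) (by linarith) p1.le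
            simpa using this
          rw [ENNReal.ofReal_rpow_of_pos (by positivity), ← ENNReal.ofReal_mul (by positivity)]
          apply ENNReal.ofReal_le_ofReal
          have d3 : 0 < ds ^ 3 := by positivity
          calc J' * ds ^ 3 ≤ J ^ p * (1 * ds ^ 3) := by
                rw [one_mul]; gcongr; linarith
            _ ≤ _ := by gcongr
      _ = ENNReal.ofReal (C * ds⁻¹ ^ 2) ^ p * (ENNReal.ofReal (c * ds ^ 3) ^ (p - 1) *
            ENNReal.ofReal (c * ds ^ 3) ^ (1:ℝ)) * ENNReal.ofReal J ^ p * N := by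
          rw [ENNReal.rpow_one]; ring
      _ = _ := by
          rw [← ENNReal.rpow_add_of_nonneg _ _ (by linarith) zero_le_one, sub_add_cancel,
            ← ENNReal.mul_rpow_of_nonneg _ _ p0.le, ← ENNReal.mul_rpow_of_nonneg _ _ p0.le,
            ← ENNReal.ofReal_mul (by positivity), ← ENNReal.ofReal_mul (by positivity)]
          congr 3
          field_simp
  rw [← lintegral_inter_add_sdiff _ Ω hm]
  refine (add_le_add near far).trans ?_
  rw [← add_mul]
  gcongr
  refine (ENNReal.add_rpow_le_rpow_add _ _ p1.le).trans ?_
  rw [← ENNReal.ofReal_add (by positivity) (by positivity), ← add_mul]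

theorem lap_bdd {Ω : Set E3} (hΩo : IsOpen Ω) (hΩb : Bornology.IsBounded Ω) (hΩc : Convex ℝ Ω)
    (hne : Ω.Nonempty) {v : E3 → ℝ} (hv : ContDiffOn ℝ 2 v (closure Ω)) :
    ∃ B : ℝ, ∀ x ∈ Ω, |lap v x| ≤ B := by
  have ud : UniqueDiffOn ℝ (closure Ω) := uniqueDiffOn_convex hΩc.closure
    (hne.mono (interior_maximal subset_closure hΩo))
  have co : ContinuousOn (iteratedFDerivWithin ℝ 2 v (closure Ω)) (closure Ω) :=
    hv.continuousOn_iteratedFDerivWithin (by norm_num) ud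
  obtain ⟨B, hB⟩ := hΩb.isCompact_closure.exists_bound_of_continuousOn co
  refine ⟨∑ i : Fin 3, B, fun x hx => ?_⟩
  have ca : ContDiffAt ℝ 2 v x := (hv.mono subset_closure).contDiffAt (hΩo.mem_nhds hx)
  have h := hB x (subset_closure hx)
  rw [iteratedFDerivWithin_eq_iteratedFDeriv ud ca (subset_closure hx)] at h
  rw [lap_eq]
  refine (Finset.abs_sum_le_sum_abs _ _).trans (Finset.sum_le_sum fun i _ => ?_)
  have d : DifferentiableAt ℝ (fderiv ℝ v) x :=
    (ca.fderiv_right (m := 1) (by norm_num)).differentiableAt (by norm_num)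
  have e : pd i (pd i v) x =
      iteratedFDeriv ℝ 2 v x (fun _ => EuclideanSpace.single i (1:ℝ)) := by
    rw [iteratedFDeriv_two_apply]
    unfold pd
    rw [fderiv_clm_apply d (differentiableAt_const _)]
    simp
  rw [e, ← Real.norm_eq_abs]
  refine ((iteratedFDeriv ℝ 2 v x).le_opNorm _).trans ?_
  simpa using h

theorem W1p_localized_rhs
    (Ω : Set E3) (hΩo : IsOpen Ω) (hΩb : Bornology.IsBounded Ω) (hΩc : Convex ℝ Ω) :
    ∃ α C : ℝ, 0 < α ∧ α < 1 / 2 ∧ 0 < C ∧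
      ∀ p : ℝ, 3 / 2 - α ≤ p → p ≤ 3 + α →
      ∀ (x₀ : E3) (ds : ℝ), 0 < ds → Metric.infDist x₀ (frontier Ω) ≤ ds →
      ∀ v : E3 → ℝ, ContDiffOn ℝ 2 v (closure Ω) → (∀ x ∈ frontier Ω, v x = 0) →
        (∀ x ∈ Ω, x ∉ Metric.closedBall x₀ ds → lap v x = 0) →
        W1pN Ω p v ≤ C * ds * LpN Ω p (fun x => lap v x) := by
  rcases Ω.eq_empty_or_nonempty with rfl | hne
  · refine ⟨1 / 4, 1, by norm_num, by norm_num, by norm_num, fun p hp _ => ?_⟩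
    intro x0 ds hds _ v _ _ _
    have : p ≠ 0 := by linarith
    simp [W1pN, LpN, this]
  obtain ⟨C, hC, H⟩ := main_est hΩo hΩb hΩc hne
  refine ⟨1 / 4, C, by norm_num, by norm_num, hC, fun p hp _ => ?_⟩
  intro x0 ds hds hinf v hv h0 hl
  have hp' : 5 / 4 ≤ p := by linarith
  have p0 : 0 < p := by linarith
  obtain ⟨B, hB⟩ := lap_bdd hΩo hΩb hΩc hne hv
  have hvol : volume Ω < ⊤ := hΩb.measure_lt_top
  have hfin : ∫⁻ y, FF Ω v y ≠ ⊤ := by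
    unfold FF
    rw [lintegral_indicator hΩo.measurableSet]
    refine ne_of_lt (lt_of_le_of_lt (setLIntegral_mono' (g := fun _ => ENNReal.ofReal B)
      hΩo.measurableSet fun y hy => ?_) ?_)
    · rw [Real.enorm_eq_ofReal_abs]
      exact ENNReal.ofReal_le_ofReal (hB y hy)
    · simp only [lintegral_const, MeasurableSet.univ, Measure.restrict_apply, univ_inter]
      exact ENNReal.mul_lt_top ENNReal.ofReal_lt_top hvol
  have key := H x0 ds p hds hp' hinf v hv h0 hl hfin
  have hint : IntegrableOn (fun x => |lap v x| ^ p) Ω := by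
    refine Measure.integrableOn_of_bounded (M := B ^ p) hvol.ne
      (((measurable_lap v).abs.pow_const p).aestronglyMeasurable) ?_
    filter_upwards [ae_restrict_mem hΩo.measurableSet] with x hx
    rw [Real.norm_of_nonneg (by positivity)]
    gcongr
    exact hB x hx
  set A := ∫ x in Ω, |lap v x| ^ p with hA
  have A0 : 0 ≤ A := integral_nonneg fun x => by positivity
  have eN : ∫⁻ y, FF Ω v y ^ p = ENNReal.ofReal A := by
    rw [hA, ofReal_integral_eq_lintegral_ofReal hint (Filter.Eventually.of_forall fun x => by positivity),
      ← lintegral_indicator hΩo.measurableSet]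
    congr 1
    ext y
    by_cases hy : y ∈ Ω
    · rw [FF, indicator_of_mem hy, indicator_of_mem hy, Real.enorm_eq_ofReal_abs,
        ENNReal.ofReal_rpow_of_nonneg (abs_nonneg _) p0.le]
    · rw [FF, indicator_of_notMem hy, indicator_of_notMem hy, ENNReal.zero_rpow_of_pos p0]
  rw [eN, ENNReal.ofReal_rpow_of_nonneg (by positivity) p0.le,
    ← ENNReal.ofReal_mul (by positivity)] at key
  have L : ∫ x in Ω, (|v x| ^ p + ‖gradient v x‖ ^ p) ≤ (C * ds) ^ p * A := by
    by_cases hi : IntegrableOn (fun x => |v x| ^ p + ‖gradient v x‖ ^ p) Ω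
    · rw [← ENNReal.ofReal_le_ofReal_iff (by positivity),
        ofReal_integral_eq_lintegral_ofReal hi (Filter.Eventually.of_forall fun x => by positivity)]
      refine le_trans (lintegral_mono fun x => ?_) key
      dsimp only
      rw [ENNReal.ofReal_add (by positivity) (by positivity),
        ← ENNReal.ofReal_rpow_of_nonneg (abs_nonneg _) p0.le,
        ← ENNReal.ofReal_rpow_of_nonneg (norm_nonneg _) p0.le, ← Real.enorm_eq_ofReal_abs,
        ofReal_norm]
      refine (ENNReal.add_rpow_le_rpow_add _ _ (by linarith)).trans ?_
      unfold SS
      gcongr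
      exact grad_le v x
    · rw [integral_undef hi]; positivity
  unfold W1pN LpN
  calc _ ≤ ((C * ds) ^ p * A) ^ (1 / p) := by
        refine Real.rpow_le_rpow (integral_nonneg fun x => by positivity) L (by positivity)
    _ = _ := by
        rw [Real.mul_rpow (by positivity) A0, ← Real.rpow_mul (by positivity),
          mul_one_div_cancel p0.ne', Real.rpow_one]
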